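/- arXiv:1901.02135 — 2 statements merged into one kernel-verified Lean document; each statement's English description precedes it below -/
import Mathlib

section
/- (Bowen, 1973.) Let (X,d) be a compact metric space, T: X→X a continuous map, and μ an ergodic T-invariant Borel probability measure. Let G_μ = {x∈X: lim_{n→∞} (1/n) Σ_{k=0}^{n−1} f(Tᵏx) = ∫_X f dμ for all continuous f: X→ℝ} be the set of generic points of μ. Then the Bowen (dimension-like) topological entropy of G_μ equals the measure-theoretic entropy: h_top^B(T, G_μ) = h_μ(T). -/
open MeasureTheory Filter Set Topology
open scoped ENNReal NNReal

namespace FlowEntropy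

variable {X : Type*}

/-- A continuous flow on `X`. -/
structure IsFlow [TopologicalSpace X] (φ : ℝ → X → X) : Prop where
  cont : Continuous fun p : ℝ × X => φ p.1 p.2
  map_zero : ∀ x, φ 0 x = x
  map_add : ∀ s t : ℝ, ∀ x, φ (s + t) x = φ s (φ t x)

/-- The flow has no fixed points. -/
def FixedPointFree (φ : ℝ → X → X) : Prop :=
  ∀ x : X, ∃ t : ℝ, φ t x ≠ x

/-- The measure `μ` is invariant under every time-`t` map of the flow. -/
def FlowInvariant [MeasurableSpace X] (φ : ℝ → X → X) (μ : Measure X) : Prop :=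
  ∀ t : ℝ, MeasurePreserving (φ t) μ μ

/-- The measure `μ` is invariant and ergodic for the flow: every Borel set invariant
under all time-`t` maps has measure `0` or `1`. -/
def FlowErgodic [MeasurableSpace X] (φ : ℝ → X → X) (μ : Measure X) : Prop :=
  FlowInvariant φ μ ∧
    ∀ B : Set X, MeasurableSet B → (∀ t : ℝ, φ t ⁻¹' B = B) → μ B = 0 ∨ μ B = 1

/-- `α` is a reparametrization on the closed interval `I` (containing the origin):
a continuous map that is a homeomorphism onto its image (equivalently, continuous and
injective on the compact interval), fixing the origin. -/
def IsReparOn (α : ℝ → ℝ) (I : Set ℝ) : Prop :=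
  ContinuousOn α I ∧ Set.InjOn α I ∧ α 0 = 0

/-- The reparametrization ball `B(x, t, ε, φ)`. -/
def reparBall [PseudoMetricSpace X] (φ : ℝ → X → X) (x : X) (t ε : ℝ) : Set X :=
  {y : X | ∃ α : ℝ → ℝ, IsReparOn α (Set.Icc 0 t) ∧
      ∀ s ∈ Set.Icc (0 : ℝ) t, dist (φ (α s) x) (φ s y) < ε}

/-- `M^s_{N,ε}(φ, Z)`: infimum of `Σ_i exp (-s t_i)` over countable families of
reparametrization balls `B(x_i, t_i, ε, φ)` with `t_i ≥ N` covering `Z`. -/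
noncomputable def coverM [PseudoMetricSpace X] (φ : ℝ → X → X) (Z : Set X) (s : ℝ) (N : ℕ)
    (ε : ℝ) : ℝ≥0∞ :=
  ⨅ (F : Set (X × ℝ)) (_ : F.Countable) (_ : ∀ p ∈ F, (N : ℝ) ≤ p.2)
    (_ : Z ⊆ ⋃ p ∈ F, reparBall φ p.1 p.2 ε),
    ∑' p : F, ENNReal.ofReal (Real.exp (-s * (p : X × ℝ).2))

/-- `M^s_ε(φ, Z) = lim_{N → ∞} M^s_{N,ε}(φ, Z)` (an increasing limit). -/
noncomputable def coverMeps [PseudoMetricSpace X] (φ : ℝ → X → X) (Z : Set X) (s ε : ℝ) :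
    ℝ≥0∞ :=
  ⨆ N : ℕ, coverM φ Z s N ε

/-- `M^s(φ, Z) = lim_{ε → 0} M^s_ε(φ, Z)` (an increasing limit as `ε` decreases). -/
noncomputable def coverMlim [PseudoMetricSpace X] (φ : ℝ → X → X) (Z : Set X) (s : ℝ) :
    ℝ≥0∞ :=
  ⨆ (ε : ℝ) (_ : 0 < ε), coverMeps φ Z s ε

/-- The Bowen entropy `h_top^B(φ, Z)`: the critical value where `M^s(φ,Z)` jumps
from `∞` to `0` (as an extended nonnegative real; `⊤` if no finite critical value). -/
noncomputable def bowenEntropy [PseudoMetricSpace X] (φ : ℝ → X → X) (Z : Set X) : ℝ≥0∞ :=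
  ⨅ (s : ℝ) (_ : 0 ≤ s) (_ : coverMlim φ Z s = 0), ENNReal.ofReal s

/-- Static entropy of a finite measurable partition, encoded as a map into a finite type. -/
noncomputable def partEnt [MeasurableSpace X] (μ : Measure X) {ι : Type*} [Fintype ι]
    (P : X → ι) : ℝ :=
  ∑ i : ι, Real.negMulLog ((μ (P ⁻¹' {i})).toReal)

/-- The measure-theoretic (Kolmogorov–Sinai) entropy of a map `T` with respect to `μ`:
the supremum over finite measurable partitions of the asymptotic entropy per unit time of
the dynamical refinements. -/
noncomputable def kolSinai [MeasurableSpace X] (μ : Measure X) (T : X → X) : ℝ≥0∞ :=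
  ⨆ (k : ℕ) (P : X → Fin k) (_ : Measurable P),
    Filter.limsup (fun n : ℕ =>
      ENNReal.ofReal (partEnt μ (fun x => fun j : Fin n => P (T^[(j : ℕ)] x)) / n))
      Filter.atTop

/-- `-log a` as a member of `ℝ≥0∞`, for `a ∈ [0,1]` (with `-log 0 = ∞`). -/
noncomputable def negLogNN (a : ℝ≥0∞) : ℝ≥0∞ :=
  if a = 0 then ⊤ else ENNReal.ofReal (-Real.log a.toReal)

/-- `-(1/t) log μ(B(x,t,ε,φ))`, as a member of `ℝ≥0∞`. -/
noncomputable def localRate [PseudoMetricSpace X] [MeasurableSpace X] (μ : Measure X)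
    (φ : ℝ → X → X) (x : X) (ε t : ℝ) : ℝ≥0∞ :=
  negLogNN (μ (reparBall φ x t ε)) / ENNReal.ofReal t

/-- The lower local entropy `underline h_μ(φ, x) = lim_{ε→0} liminf_{t→∞}
  -(1/t) log μ(B(x,t,ε,φ))` (the limit in `ε` is an increasing limit, hence a supremum). -/
noncomputable def lowerLocalEnt [PseudoMetricSpace X] [MeasurableSpace X] (μ : Measure X)
    (φ : ℝ → X → X) (x : X) : ℝ≥0∞ :=
  ⨆ (ε : ℝ) (_ : 0 < ε), Filter.liminf (fun t : ℝ => localRate μ φ x ε t) Filter.atTop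

/-- The upper local entropy `overline h_μ(φ, x) = lim_{ε→0} limsup_{t→∞}
  -(1/t) log μ(B(x,t,ε,φ))`. -/
noncomputable def upperLocalEnt [PseudoMetricSpace X] [MeasurableSpace X] (μ : Measure X)
    (φ : ℝ → X → X) (x : X) : ℝ≥0∞ :=
  ⨆ (ε : ℝ) (_ : 0 < ε), Filter.limsup (fun t : ℝ => localRate μ φ x ε t) Filter.atTop

/-- The set `G_μ(φ)` of generic points of `μ` for the flow `φ`. -/
def genericPts [TopologicalSpace X] [MeasurableSpace X] (φ : ℝ → X → X) (μ : Measure X) :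
    Set X :=
  {x : X | ∀ f : C(X, ℝ),
    Filter.Tendsto (fun t : ℝ => (1 / t) * ∫ τ in (0 : ℝ)..t, f (φ τ x))
      Filter.atTop (nhds (∫ y, f y ∂μ))}


/-- The Bowen ball `B_n(x, ε)` for a map `T`. -/
def bowenBallMap [PseudoMetricSpace X] (T : X → X) (x : X) (n : ℕ) (ε : ℝ) : Set X :=
  {y : X | ∀ j < n, dist (T^[j] x) (T^[j] y) < ε}

/-- `M^s_{N,ε}(T, Z)` for a map `T`: infimum of `Σ_i exp (-s n_i)` over countable covers
of `Z` by Bowen balls `B_{n_i}(x_i, ε)` with `n_i ≥ N`. -/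
noncomputable def coverMMap [PseudoMetricSpace X] (T : X → X) (Z : Set X) (s : ℝ) (N : ℕ)
    (ε : ℝ) : ℝ≥0∞ :=
  ⨅ (F : Set (X × ℕ)) (_ : F.Countable) (_ : ∀ p ∈ F, N ≤ p.2)
    (_ : Z ⊆ ⋃ p ∈ F, bowenBallMap T p.1 p.2 ε),
    ∑' p : F, ENNReal.ofReal (Real.exp (-s * ((p : X × ℕ).2 : ℝ)))

/-- `M^s_ε(T, Z) = lim_{N→∞} M^s_{N,ε}(T, Z)` (an increasing limit). -/
noncomputable def coverMMapEps [PseudoMetricSpace X] (T : X → X) (Z : Set X) (s ε : ℝ) :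
    ℝ≥0∞ :=
  ⨆ N : ℕ, coverMMap T Z s N ε

/-- `M^s(T, Z) = lim_{ε→0} M^s_ε(T, Z)` (an increasing limit as `ε` decreases). -/
noncomputable def coverMMapLim [PseudoMetricSpace X] (T : X → X) (Z : Set X) (s : ℝ) :
    ℝ≥0∞ :=
  ⨆ (ε : ℝ) (_ : 0 < ε), coverMMapEps T Z s ε

/-- The Bowen (dimension-like) topological entropy `h_top^B(T, Z)` of a subset `Z` for a
map `T`. -/
noncomputable def bowenEntropyMap [PseudoMetricSpace X] (T : X → X) (Z : Set X) : ℝ≥0∞ :=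
  ⨅ (s : ℝ) (_ : 0 ≤ s) (_ : coverMMapLim T Z s = 0), ENNReal.ofReal s

/-- The set of generic points of `μ` for a map `T`. -/
def genericPtsMap [TopologicalSpace X] [MeasurableSpace X] (T : X → X) (μ : Measure X) :
    Set X :=
  {x : X | ∀ f : C(X, ℝ),
    Filter.Tendsto (fun n : ℕ => (1 / (n : ℝ)) * ∑ k ∈ Finset.range n, f (T^[k] x))
      Filter.atTop (nhds (∫ y, f y ∂μ))}

section Kraft

variable {ι : Type*}

/-- The `P`-name of length `n` of the orbit of `x` under `T`. -/
def itinerary (T : X → X) (P : X → ι) (n : ℕ) (x : X) : Fin n → ι :=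
  fun j => P (T^[(j : ℕ)] x)

/-- The cost function `c` satisfies a Kraft inequality for the `P`-names of length `n` of the
points of `S`: up to the exponential, it dominates a subprobability vector on names. -/
def KraftOn [Fintype ι] (T : X → X) (P : X → ι) (S : Set X) (n : ℕ) (c : X → ℝ) : Prop :=
  ∃ B : (Fin n → ι) → ℝ, (∀ u, 0 ≤ B u) ∧ ∑ u, B u ≤ 1 ∧
    ∀ x ∈ S, Real.exp (-c x) ≤ B (itinerary T P n x)

theorem measurable_itinerary [MeasurableSpace X] [MeasurableSpace ι] {T : X → X}
    {P : X → ι} (hT : Measurable T)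
    (hP : Measurable P) (n : ℕ) : Measurable (itinerary T P n) :=
  measurable_pi_lambda _ fun j => hP.comp (hT.iterate j)

variable [Fintype ι] {T : X → X} {P : X → ι}

theorem KraftOn.mono {S S' : Set X} {n : ℕ} {c c' : X → ℝ} (h : KraftOn T P S n c)
    (hS : S' ⊆ S) (hc : ∀ x ∈ S', c x ≤ c' x) : KraftOn T P S' n c' := by
  obtain ⟨B, h0, h1, h2⟩ := h
  exact ⟨B, h0, h1, fun x hx =>
    (Real.exp_le_exp.2 (neg_le_neg (hc x hx))).trans (h2 x (hS hx))⟩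

theorem KraftOn.mixture {κ : Type*} (s : Finset κ) {S : Set X} {n : ℕ} {c : X → ℝ} (a : κ → ℝ)
    (Si : κ → Set X) (ci : κ → X → ℝ) (ha : ∀ i ∈ s, 0 ≤ a i) (hsum : ∑ i ∈ s, a i ≤ 1)
    (hK : ∀ i ∈ s, KraftOn T P (Si i) n (ci i))
    (hc : ∀ x ∈ S, ∃ i ∈ s, x ∈ Si i ∧ Real.exp (-c x) ≤ a i * Real.exp (-ci i x)) :
    KraftOn T P S n c := by
  choose! B h0 h1 h2 using hK
  refine ⟨fun u => ∑ i ∈ s, a i * B i u, fun u => Finset.sum_nonneg fun i hi =>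
    mul_nonneg (ha i hi) (h0 i hi u), ?_, fun x hx => ?_⟩
  · rw [Finset.sum_comm]
    refine le_trans (Finset.sum_le_sum fun i hi => ?_) hsum
    rw [← Finset.mul_sum]
    exact mul_le_of_le_one_right (ha i hi) (h1 i hi)
  · obtain ⟨i, hi, hxi, hle⟩ := hc x hx
    refine hle.trans ((mul_le_mul_of_nonneg_left (h2 i hi x hxi) (ha i hi)).trans ?_)
    exact Finset.single_le_sum (f := fun i => a i * B i (itinerary T P n x))
      (fun j hj => mul_nonneg (ha j hj) (h0 j hj _)) hi

theorem KraftOn.average {q : ℕ} (hq : 0 < q) {S : Set X} {n : ℕ} (c : ℕ → X → ℝ)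
    (hK : ∀ j < q, KraftOn T P S n (c j)) :
    KraftOn T P S n (fun x => (q : ℝ)⁻¹ * ∑ j ∈ Finset.range q, c j x) := by
  choose! B h0 h1 h2 using hK
  have hq' : (0 : ℝ) < q := by exact_mod_cast hq
  refine ⟨fun u => ∑ j ∈ Finset.range q, (q : ℝ)⁻¹ * B j u, fun u =>
    Finset.sum_nonneg fun j hj => mul_nonneg (by positivity) (h0 j (Finset.mem_range.1 hj) u),
    ?_, fun x hx => ?_⟩
  · rw [Finset.sum_comm]
    refine (Finset.sum_le_sum fun j hj => ?_).trans
      (b := ∑ j ∈ Finset.range q, (q : ℝ)⁻¹) ?_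
    · rw [← Finset.mul_sum]
      exact mul_le_of_le_one_right (by positivity) (h1 j (Finset.mem_range.1 hj))
    · simp [hq'.ne']
  · have := convexOn_exp.map_sum_le (t := Finset.range q) (w := fun _ => (q : ℝ)⁻¹)
      (p := fun j => -c j x) (fun _ _ => by positivity) (by simp [hq'.ne']) (by simp)
    simp only [smul_eq_mul] at this
    rw [← Finset.mul_sum, Finset.sum_neg_distrib, mul_neg] at this
    refine this.trans (Finset.sum_le_sum fun j hj => ?_)
    exact mul_le_mul_of_nonneg_left (h2 j (Finset.mem_range.1 hj) x hx) (by positivity)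

theorem KraftOn.append {S S' : Set X} {l m : ℕ} {c c' : X → ℝ} (h : KraftOn T P S l c)
    (h' : KraftOn T P S' m c') :
    KraftOn T P (S ∩ T^[l] ⁻¹' S') (l + m) (fun x => c x + c' (T^[l] x)) := by
  obtain ⟨B, h0, h1, h2⟩ := h
  obtain ⟨B', h0', h1', h2'⟩ := h'
  refine ⟨fun u => B (fun i => u (Fin.castAdd m i)) * B' (fun i => u (Fin.natAdd l i)),
    fun u => mul_nonneg (h0 _) (h0' _), ?_, fun x hx => ?_⟩
  · rw [← (Fin.appendEquiv l m).sum_comp]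
    simp only [Fin.appendEquiv, Equiv.coe_fn_mk, Fin.append_left, Fin.append_right]
    rw [Fintype.sum_prod_type, ← Fintype.sum_mul_sum]
    exact mul_le_one₀ h1 (Finset.sum_nonneg fun u _ => h0' u) h1'
  · rw [neg_add, Real.exp_add]
    refine mul_le_mul (h2 x hx.1) ((h2' _ hx.2).trans_eq ?_) (Real.exp_pos _).le (h0 _)
    congr 1
    funext i
    simp only [itinerary, Fin.val_natAdd]
    rw [add_comm l, Function.iterate_add_apply]

theorem KraftOn.append_univ {l m : ℕ} {c c' : X → ℝ} (h : KraftOn T P univ l c)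
    (h' : KraftOn T P univ m c') :
    KraftOn T P univ (l + m) (fun x => c x + c' (T^[l] x)) :=
  (h.append h').mono (by simp) fun _ _ => le_rfl

theorem kraftOn_zero (S : Set X) : KraftOn T P S 0 0 :=
  ⟨fun _ => 1, by simp, by simp, by simp⟩

theorem kraftOn_uniform [Nonempty ι] (n : ℕ) :
    KraftOn T P univ n (fun _ => n * Real.log (Fintype.card ι)) := by
  have hk : (0 : ℝ) < Fintype.card ι := by exact_mod_cast Fintype.card_pos
  refine ⟨fun _ => ((Fintype.card ι : ℝ) ^ n)⁻¹, fun _ => by positivity, ?_, fun x _ => ?_⟩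
  · simp [hk.ne']
  · rw [Real.exp_neg, Real.exp_nat_mul, Real.exp_log hk]

theorem KraftOn.iterate {q : ℕ} {c : X → ℝ} (h : KraftOn T P univ q c) (m : ℕ) :
    KraftOn T P univ (q * m) (fun x => ∑ l ∈ Finset.range m, c (T^[q * l] x)) := by
  induction m with
  | zero => exact (kraftOn_zero univ).mono subset_rfl (by simp)
  | succ m ih =>
    refine (ih.append_univ h).mono subset_rfl fun x _ => ?_
    rw [Finset.sum_range_succ]

/-- Averaging over the `q` possible phases of a decomposition into blocks of length `q`. -/
theorem KraftOn.birkhoffSum [Nonempty ι] {q : ℕ} (hq : 0 < q) {c : X → ℝ}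
    (h : KraftOn T P univ q c) (m : ℕ) :
    KraftOn T P univ (q * m + q) (fun x =>
      q * Real.log (Fintype.card ι) + (q : ℝ)⁻¹ * birkhoffSum T c (q * m) x) := by
  have hq' : (0 : ℝ) < q := by exact_mod_cast hq
  have key : ∀ j < q, KraftOn T P univ (q * m + q) (fun x =>
      q * Real.log (Fintype.card ι) +
        ∑ l ∈ Finset.range m, c (T^[q * l] (T^[j] x))) := by
    intro j hj
    have h1 := ((kraftOn_uniform (T := T) (P := P) j).append_univ (h.iterate m)).append_univ
      (kraftOn_uniform (T := T) (P := P) (q - j))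
    have e : j + q * m + (q - j) = q * m + q := by lia
    rw [e] at h1
    refine h1.mono subset_rfl fun x _ => ?_
    rw [Nat.cast_sub hj.le]
    apply le_of_eq
    ring
  refine (KraftOn.average hq _ key).mono subset_rfl fun x _ => le_of_eq ?_
  rw [Finset.sum_add_distrib, mul_add, Finset.sum_const, Finset.card_range, nsmul_eq_mul,
    inv_mul_cancel_left₀ hq'.ne']
  congr 2
  clear key
  rw [Finset.sum_comm, _root_.birkhoffSum]
  induction m with
  | zero => simp
  | succ m ih =>
    rw [Finset.sum_range_succ, ih, mul_add, mul_one, Finset.sum_range_add]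
    simp only [← Function.iterate_add_apply]

theorem KraftOn.card_le [DecidableEq ι] {n : ℕ} {c : X → ℝ} {S : Set X} {b : ℝ}
    (h : KraftOn T P S n c) (hb : ∀ x ∈ S, c x ≤ b) (s : Finset (Fin n → ι))
    (hs : ∀ u ∈ s, ∃ x ∈ S, itinerary T P n x = u) : (s.card : ℝ) ≤ Real.exp b := by
  obtain ⟨B, h0, h1, h2⟩ := h
  have : (s.card : ℝ) * Real.exp (-b) ≤ 1 := by
    refine le_trans ?_ ((Finset.sum_le_univ_sum_of_nonneg (s := s) h0).trans h1)
    rw [← nsmul_eq_mul]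
    refine Finset.card_nsmul_le_sum _ _ _ fun u hu => ?_
    obtain ⟨x, hx, rfl⟩ := hs u hu
    exact (Real.exp_le_exp.2 (neg_le_neg (hb x hx))).trans (h2 x hx)
  rwa [Real.exp_neg, mul_inv_le_iff₀ (Real.exp_pos _), one_mul] at this

theorem partEnt_eq_integral [MeasurableSpace X] {κ : Type*} [Fintype κ] [MeasurableSpace κ]
    [MeasurableSingletonClass κ]
    {μ : Measure X} [IsProbabilityMeasure μ] {Q : X → κ} (hQ : Measurable Q) (f : κ → ℝ) :
    ∫ x, f (Q x) ∂μ = ∑ u, (μ (Q ⁻¹' {u})).toReal * f u := by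
  have : IsFiniteMeasure (μ.map Q) := inferInstance
  rw [← integral_map hQ.aemeasurable (f := f) (by fun_prop),
    integral_fintype (Integrable.of_finite)]
  refine Finset.sum_congr rfl fun u _ => ?_
  rw [measureReal_def, Measure.map_apply hQ (measurableSet_singleton u), smul_eq_mul]

/-- Gibbs' inequality. -/
theorem KraftOn.partEnt_le [MeasurableSpace X] [MeasurableSpace ι] [MeasurableSingletonClass ι]
    {μ : Measure X} [IsProbabilityMeasure μ] (hT : Measurable T) (hP : Measurable P)
    {n : ℕ} {c : X → ℝ} (h : KraftOn T P univ n c) (hc : Integrable c μ) :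
    partEnt μ (itinerary T P n) ≤ ∫ x, c x ∂μ := by
  obtain ⟨B, h0, h1, h2⟩ := h
  have hQ := measurable_itinerary (n := n) hT hP
  have hpos : ∀ u, μ (itinerary T P n ⁻¹' {u}) ≠ 0 → 0 < B u := by
    intro u hu
    obtain ⟨x, hx⟩ := nonempty_of_measure_ne_zero hu
    obtain rfl : itinerary T P n x = u := hx
    exact (Real.exp_pos _).trans_le (h2 x (mem_univ x))
  have hle : ∫ x, -Real.log (B (itinerary T P n x)) ∂μ ≤ ∫ x, c x ∂μ := by
    refine integral_mono ((Integrable.of_finite (μ := μ.map (itinerary T P n))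
      (f := fun u => -Real.log (B u))).comp_measurable hQ) hc fun x => ?_
    have := Real.log_le_log (Real.exp_pos _) (h2 x (mem_univ x))
    rw [Real.log_exp] at this
    change -Real.log (B (itinerary T P n x)) ≤ c x
    linarith
  refine le_trans ?_ hle
  rw [partEnt_eq_integral hQ (fun u => -Real.log (B u)), partEnt]
  have hsum : ∑ u, (μ (itinerary T P n ⁻¹' {u})).toReal = 1 := by
    have := partEnt_eq_integral (μ := μ) hQ (fun _ => 1)
    simpa using this.symm
  have hterm : ∀ u, Real.negMulLog ((μ (itinerary T P n ⁻¹' {u})).toReal) ≤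
      (μ (itinerary T P n ⁻¹' {u})).toReal * (-Real.log (B u)) +
        (B u - (μ (itinerary T P n ⁻¹' {u})).toReal) := by
    intro u
    set p := (μ (itinerary T P n ⁻¹' {u})).toReal with hp
    by_cases hu : μ (itinerary T P n ⁻¹' {u}) = 0
    · simp [hp, hu, h0]
    · have hp0 : 0 < p := ENNReal.toReal_pos hu (measure_ne_top _ _)
      have hB := hpos u hu
      have := Real.log_le_sub_one_of_pos (div_pos hB hp0)
      rw [Real.log_div hB.ne' hp0.ne'] at this
      have := mul_le_mul_of_nonneg_left this hp0.le
      rw [mul_sub, mul_sub, mul_div_cancel₀ _ hp0.ne'] at this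
      rw [Real.negMulLog]
      linarith
  refine (Finset.sum_le_sum fun u _ => hterm u).trans ?_
  rw [Finset.sum_add_distrib, Finset.sum_sub_distrib, hsum]
  linarith

end Kraft

section Birkhoff

variable [MeasurableSpace X]

/-- If `∫ f < 0`, the Birkhoff sums of `f` are almost everywhere bounded above. -/
theorem ae_bddAbove_birkhoffSum {T : X → X} {μ : Measure X} [IsProbabilityMeasure μ]
    (herg : Ergodic T μ) {f : X → ℝ} (hf : Measurable f) (hfi : Integrable f μ)
    (hneg : ∫ x, f x ∂μ < 0) :
    ∀ᵐ x ∂μ, BddAbove (range fun n => birkhoffSum T f n x) := by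
  have hT := herg.measurable
  set M : ℕ → X → ℝ := fun n x => (Finset.range (n + 1)).sup' (by simp) fun k => birkhoffSum T f k x
    with hM
  have hS : ∀ n, Measurable (birkhoffSum T f n) := fun n =>
    Finset.measurable_sum _ fun k _ => hf.comp (hT.iterate k)
  have hSi : ∀ n, Integrable (birkhoffSum T f n) μ := fun n =>
    integrable_finsetSum _ fun k _ =>
      (herg.toMeasurePreserving.iterate k).integrable_comp_of_integrable hfi
  have hMmono : ∀ x, Monotone fun n => M n x := fun x m n hmn =>
    Finset.sup'_mono _ (Finset.range_mono (by lia)) _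
  have hM0 : ∀ n x, 0 ≤ M n x := fun n x => by
    have := Finset.le_sup' (s := Finset.range (n + 1)) (fun k => birkhoffSum T f k x)
      (b := 0) (by simp)
    simpa using this
  have hMs : ∀ n x, M (n + 1) x = max 0 (f x + M n (T x)) := by
    intro n x
    apply le_antisymm
    · refine Finset.sup'_le _ _ fun k hk => ?_
      rcases k with _ | k
      · simp
      · refine le_max_of_le_right ?_
        rw [birkhoffSum_succ']
        gcongr
        exact Finset.le_sup' (fun k => birkhoffSum T f k (T x))
          (by simp only [Finset.mem_range] at hk ⊢; lia)
    · refine max_le (hM0 _ _) ?_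
      rw [← le_sub_iff_add_le']
      refine Finset.sup'_le _ _ fun k hk => ?_
      rw [le_sub_iff_add_le', ← birkhoffSum_succ']
      exact Finset.le_sup' (fun k => birkhoffSum T f k x)
          (by simp only [Finset.mem_range] at hk ⊢; lia)
  have hMm : ∀ n, Measurable (M n) := fun n => by
    have := Finset.measurable_range_sup' (n := n) (f := fun k => birkhoffSum T f k)
      (fun k _ => hS k)
    convert this using 1
    funext x
    simp [hM, Finset.sup'_apply]
  have hMi : ∀ n, Integrable (M n) μ := by
    intro n
    induction n with
    | zero => simp [hM]
    | succ n ih =>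
      have : M (n + 1) = fun x => max 0 (f x + M n (T x)) := funext (hMs n)
      rw [this]
      exact (integrable_zero _ _ _).sup (hfi.add
        (herg.toMeasurePreserving.integrable_comp_of_integrable ih))
  set A : Set X := {x | ¬ BddAbove (range fun n => M n x)} with hA
  have hAeq : T ⁻¹' A = A := by
    ext x
    simp only [hA, mem_preimage, mem_ofPred_eq, not_iff_not]
    constructor
    · rintro ⟨b, hb⟩
      refine ⟨max 0 (f x + b), ?_⟩
      rintro _ ⟨n, rfl⟩
      refine (hMmono x (Nat.le_succ n)).trans ?_
      refine (hMs n x).trans_le ?_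
      gcongr
      exact hb ⟨n, rfl⟩
    · rintro ⟨b, hb⟩
      refine ⟨b - f x, ?_⟩
      rintro _ ⟨n, rfl⟩
      have := hb ⟨n + 1, rfl⟩
      simp only [hMs] at this
      have := (le_max_right _ _).trans this
      simp only
      linarith
  have hAm : MeasurableSet A := (measurableSet_bddAbove_range hMm).compl
  have hA0 : μ A = 0 := by
    rcases herg.toPreErgodic.prob_eq_zero_or_one hAm hAeq with h | h
    · exact h
    exfalso
    have hAae : ∀ᵐ x ∂μ, x ∈ A := (prob_compl_eq_zero_iff hAm).2 h
    have hlim : Tendsto (fun n => ∫ x, M (n + 1) x - M n (T x) ∂μ) atTop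
        (𝓝 (∫ x, f x ∂μ)) := by
      refine tendsto_integral_of_dominated_convergence (fun x => |f x|)
        (fun n => ((hMm _).sub ((hMm n).comp hT)).aestronglyMeasurable) hfi.abs ?_ ?_
      · intro n
        refine ae_of_all _ fun x => ?_
        rw [hMs, Real.norm_eq_abs]
        have := hM0 n (T x)
        rcases max_cases 0 (f x + M n (T x)) with ⟨h1, h2⟩ | ⟨h1, h2⟩ <;> rw [h1]
        · rw [abs_le]
          constructor
          · have := neg_abs_le (f x)
            linarith
          · have := abs_nonneg (f x)
            linarith
        · simp
      · filter_upwards [hAae] with x hx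
        have hTx : T x ∈ A := by
          have : x ∈ T ⁻¹' A := hAeq.symm ▸ hx
          exact this
        have hinf : Tendsto (fun n => M n (T x)) atTop atTop :=
          tendsto_atTop_atTop_of_monotone' (hMmono _) hTx
        refine tendsto_const_nhds.congr' ?_
        filter_upwards [hinf.eventually_ge_atTop (-f x)] with n hn
        rw [hMs, max_eq_right (by linarith)]
        ring
    refine absurd (ge_of_tendsto' hlim fun n => ?_) hneg.not_ge
    have e : ∫ x, M n (T x) ∂μ = ∫ x, M n x ∂μ := by
      rw [← integral_map hT.aemeasurable (hMm n).aestronglyMeasurable, herg.map_eq]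
    rw [integral_sub (f := M (n + 1)) (g := fun x => M n (T x)) (hMi _)
      (herg.toMeasurePreserving.integrable_comp_of_integrable (hMi n)), e]
    exact sub_nonneg.2 (integral_mono (hMi _) (hMi _) fun x => hMmono x (Nat.le_succ n))
  have : ∀ᵐ x ∂μ, x ∉ A := measure_eq_zero_iff_ae_notMem.1 hA0
  filter_upwards [this] with x hx
  obtain ⟨b, hb⟩ := not_not.1 hx
  refine ⟨b, ?_⟩
  rintro _ ⟨n, rfl⟩
  exact (Finset.le_sup' (fun k => birkhoffSum T f k x) (by simp)).trans (hb ⟨n, rfl⟩)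

theorem ae_eventually_birkhoffSum_le {T : X → X} {μ : Measure X} [IsProbabilityMeasure μ]
    (herg : Ergodic T μ) {f : X → ℝ} (hf : Measurable f) (hfi : Integrable f μ) {b : ℝ}
    (hb : ∫ x, f x ∂μ < b) :
    ∀ᵐ x ∂μ, ∀ᶠ n : ℕ in atTop, (1 / (n : ℝ)) * birkhoffSum T f n x < b := by
  obtain ⟨a, ha, hab⟩ := exists_between hb
  have h := ae_bddAbove_birkhoffSum herg (f := fun x => f x - a) (hf.sub_const a)
    (hfi.sub (integrable_const a)) (by
      rw [integral_sub hfi (integrable_const a)]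
      simpa using ha)
  filter_upwards [h] with x ⟨C, hC⟩
  have hlim : Tendsto (fun n : ℕ => a + C / n) atTop (𝓝 a) := by
    simpa using tendsto_const_nhds.add (tendsto_const_div_atTop_nhds_zero_nat C)
  filter_upwards [hlim.eventually (gt_mem_nhds hab), eventually_gt_atTop 0] with n hn hn0
  refine lt_of_le_of_lt ?_ hn
  have hn' : (0 : ℝ) < n := by exact_mod_cast hn0
  have : birkhoffSum T (fun x => f x - a) n x ≤ C := hC ⟨n, rfl⟩
  simp only [birkhoffSum, Finset.sum_sub_distrib, Finset.sum_const, Finset.card_range,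
    nsmul_eq_mul] at this ⊢
  rw [one_div, inv_mul_le_iff₀ hn', mul_add, mul_div_cancel₀ _ hn'.ne']
  linarith

/-- **Birkhoff's pointwise ergodic theorem** for an ergodic probability measure. -/
theorem ae_tendsto_birkhoffAverage {T : X → X} {μ : Measure X} [IsProbabilityMeasure μ]
    (herg : Ergodic T μ) {f : X → ℝ} (hf : Measurable f) (hfi : Integrable f μ) :
    ∀ᵐ x ∂μ, Tendsto (fun n : ℕ => (1 / (n : ℝ)) * birkhoffSum T f n x) atTop
      (𝓝 (∫ x, f x ∂μ)) := by
  have h1 : ∀ᵐ x ∂μ, ∀ k : ℕ, ∀ᶠ n : ℕ in atTop,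
      (1 / (n : ℝ)) * birkhoffSum T f n x < ∫ x, f x ∂μ + 1 / ((k : ℝ) + 1) :=
    ae_all_iff.2 fun k => ae_eventually_birkhoffSum_le herg hf hfi
      (lt_add_of_pos_right _ (by positivity))
  have h2 : ∀ᵐ x ∂μ, ∀ k : ℕ, ∀ᶠ n : ℕ in atTop,
      (1 / (n : ℝ)) * birkhoffSum T (-f) n x < ∫ x, (-f) x ∂μ + 1 / ((k : ℝ) + 1) :=
    ae_all_iff.2 fun k => ae_eventually_birkhoffSum_le herg hf.neg hfi.neg
      (lt_add_of_pos_right _ (by positivity))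
  filter_upwards [h1, h2] with x hx1 hx2
  rw [Metric.tendsto_atTop']
  intro ε hε
  obtain ⟨k, hk⟩ := exists_nat_one_div_lt hε
  obtain ⟨N, hN⟩ := eventually_atTop.1 ((hx1 k).and (hx2 k))
  refine ⟨N, fun n hn => ?_⟩
  obtain ⟨a1, a2⟩ := hN n hn.le
  simp only [birkhoffSum, Pi.neg_apply, integral_neg, Finset.sum_neg_distrib] at a1 a2 ⊢
  rw [Real.dist_eq, abs_lt]
  constructor <;> linarith

end Birkhoff

theorem ae_mem_genericPtsMap [MetricSpace X] [CompactSpace X] [MeasurableSpace X] [BorelSpace X]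
    {T : X → X} {μ : Measure X} [IsProbabilityMeasure μ] (herg : Ergodic T μ) :
    ∀ᵐ x ∂μ, x ∈ genericPtsMap T μ := by
  have hint : ∀ f : C(X, ℝ), Integrable f μ := fun f =>
    f.continuous.integrable_of_hasCompactSupport (HasCompactSupport.of_compactSpace _)
  have h : ∀ᵐ x ∂μ, ∀ m : ℕ, Tendsto (fun n : ℕ => (1 / (n : ℝ)) *
      birkhoffSum T (TopologicalSpace.denseSeq C(X, ℝ) m) n x) atTop
      (𝓝 (∫ x, TopologicalSpace.denseSeq C(X, ℝ) m x ∂μ)) :=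
    ae_all_iff.2 fun m => ae_tendsto_birkhoffAverage herg (ContinuousMap.measurable _) (hint _)
  filter_upwards [h] with x hx f
  rw [Metric.tendsto_atTop]
  intro ε hε
  obtain ⟨m, hm⟩ := (TopologicalSpace.denseRange_denseSeq C(X, ℝ)).exists_dist_lt f
    (show 0 < ε / 3 by positivity)
  set g := TopologicalSpace.denseSeq C(X, ℝ) m
  obtain ⟨N, hN⟩ := Metric.tendsto_atTop.1 (hx m) (ε / 3) (by positivity)
  refine ⟨N, fun n hn => ?_⟩
  have hfg : ∀ y, |f y - g y| ≤ ε / 3 := fun y =>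
    ((ContinuousMap.dist_apply_le_dist y).trans hm.le)
  have e1 : |(1 / (n : ℝ)) * ∑ k ∈ Finset.range n, f (T^[k] x) -
      (1 / (n : ℝ)) * birkhoffSum T g n x| ≤ ε / 3 := by
    rw [← mul_sub, birkhoffSum, ← Finset.sum_sub_distrib, abs_mul]
    rcases Nat.eq_zero_or_pos n with rfl | hn0
    · simp; positivity
    have hn' : (0 : ℝ) < n := by exact_mod_cast hn0
    rw [abs_of_pos (by positivity), one_div, inv_mul_le_iff₀ hn']
    refine (Finset.abs_sum_le_sum_abs _ _).trans ((Finset.sum_le_sum fun k _ => hfg _).trans ?_)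
    simp
  have e2 : |∫ y, g y ∂μ - ∫ y, f y ∂μ| ≤ ε / 3 := by
    rw [← integral_sub (hint g) (hint f)]
    have := norm_integral_le_of_norm_le_const (μ := μ) (f := fun y => g y - f y) (C := ε / 3)
      (ae_of_all _ fun y => by rw [Real.norm_eq_abs, abs_sub_comm]; exact hfg y)
    simpa using this
  have e3 := hN n hn
  rw [Real.dist_eq] at e3 ⊢
  rw [abs_le] at e1 e2
  rw [abs_lt] at e3 ⊢
  constructor <;> linarith [e1.1, e1.2, e2.1, e2.2, e3.1, e3.2]

section LowerBound

variable {ι : Type*} [Fintype ι] {T : X → X} {P : X → ι}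

theorem kraftOn_one_of_const [DecidableEq ι] {S : Set X} (a : ι) (h : ∀ x ∈ S, P x = a) :
    KraftOn T P S 1 0 := by
  refine ⟨fun u => if u = fun _ => a then 1 else 0, fun u => by dsimp only; split_ifs <;> simp,
    by simp, fun x hx => ?_⟩
  have : itinerary T P 1 x = fun _ => a := by
    funext i
    obtain rfl := Subsingleton.elim i 0
    exact h x hx
  simp [this]

/-- On a set `S` on which `P` is constant along `K`, the one-letter names can be coded with cost
`η` on `K`, and a larger constant off `K`. -/
theorem kraftOn_one [DecidableEq ι] [Nonempty ι] {S K : Set X} {η : ℝ} (hη : 0 < η) (a : ι)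
    (h : ∀ x ∈ S, x ∈ K → P x = a) :
    KraftOn T P S 1 (fun y => η + Kᶜ.indicator
      (fun _ => Real.log (Fintype.card ι) - Real.log (1 - Real.exp (-η))) y) := by
  have hlt : Real.exp (-η) < 1 := by simpa using hη
  refine KraftOn.mixture (Finset.univ : Finset Bool)
    (fun o => bif o then Real.exp (-η) else 1 - Real.exp (-η))
    (fun o => bif o then S ∩ K else univ)
    (fun o => bif o then 0 else fun _ => (1 : ℕ) * Real.log (Fintype.card ι)) ?_ (by simp) ?_ ?_
  · rintro (_ | _) _
    · simpa using hη.le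
    · simpa using (Real.exp_pos _).le
  · rintro (_ | _) _
    · exact kraftOn_uniform 1
    · exact kraftOn_one_of_const a fun x hx => h x hx.1 hx.2
  · intro x hx
    by_cases hK : x ∈ K
    · exact ⟨true, by simp, ⟨hx, hK⟩, by simp [hK]⟩
    · refine ⟨false, by simp, mem_univ _, ?_⟩
      rw [indicator_of_mem (show x ∈ Kᶜ from hK)]
      simp only [cond_false, Nat.cast_one, one_mul]
      calc Real.exp (-(η + (Real.log (Fintype.card ι) - Real.log (1 - Real.exp (-η)))))
          ≤ Real.exp (Real.log (1 - Real.exp (-η)) + -Real.log (Fintype.card ι)) :=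
            Real.exp_le_exp.2 (by linarith)
        _ = _ := by rw [Real.exp_add, Real.exp_log (by linarith)]

theorem kraftOn_bowenBallMap [PseudoMetricSpace X] {g : X → ℝ} {ε : ℝ}
    (h : ∀ x, KraftOn T P {y | dist x y < ε} 1 g) (n : ℕ) (x : X) :
    KraftOn T P (bowenBallMap T x n ε) n (birkhoffSum T g n) := by
  induction n generalizing x with
  | zero => exact (kraftOn_zero _).mono subset_rfl (by simp)
  | succ n ih =>
    have := (h x).append (ih (T x))
    rw [add_comm 1 n] at this
    refine this.mono (fun y hy => ⟨?_, fun j hj => ?_⟩) fun y _ => ?_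
    · simpa using hy 0 (by simp)
    · exact hy (j + 1) (by lia)
    · rw [birkhoffSum_succ']
      rfl

/-- Orbits can be coded by successively parsing them into pieces lying in the sets `U p`,
falling back on single letters when outside of these sets. -/
theorem kraftOn_parse [Nonempty ι] {κ : Type*} (F : Finset κ) (len : κ → ℕ) (U : κ → Set X)
    {g : X → ℝ} (hg : ∀ x, 0 ≤ g x) {s : ℝ} (hs : 0 ≤ s) {L : ℕ}
    (h1 : ∀ p ∈ F, 1 ≤ len p) (hL : ∀ p ∈ F, len p ≤ L)
    (hsum : ∑ p ∈ F, Real.exp (-s * len p) ≤ 1 / 2)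
    (hK : ∀ p ∈ F, KraftOn T P (U p) (len p) (birkhoffSum T g (len p))) (n : ℕ) :
    KraftOn T P univ n (fun x => birkhoffSum T (fun y => s + g y +
      (⋃ p ∈ F, U p)ᶜ.indicator (fun _ => Real.log (2 * Fintype.card ι)) y) n x +
      L * Real.log (Fintype.card ι)) := by
  set Bad : Set X := (⋃ p ∈ F, U p)ᶜ with hBad
  set k : ℝ := (Fintype.card ι : ℝ) with hk
  have hk1 : 1 ≤ k := by
    rw [hk]
    exact_mod_cast Nat.succ_le_of_lt Fintype.card_pos
  have hlogk : 0 ≤ Real.log k := Real.log_nonneg hk1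
  have hlog2k : 0 ≤ Real.log (2 * k) := Real.log_nonneg (by linarith)
  set h : X → ℝ := fun y => s + g y + Bad.indicator (fun _ => Real.log (2 * k)) y with hh
  have hind : ∀ y, 0 ≤ Bad.indicator (fun _ => Real.log (2 * k)) y := fun y =>
    indicator_nonneg (fun _ _ => hlog2k) y
  have hh0 : ∀ y, 0 ≤ h y := fun y => by
    have := hg y
    have := hind y
    simp only [hh]
    linarith
  have hgh : ∀ y, s + g y ≤ h y := fun y => by
    have := hind y
    simp only [hh]
    linarith
  have hS0 : ∀ n y, 0 ≤ birkhoffSum T h n y := fun n y => Finset.sum_nonneg fun _ _ => hh0 _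
  induction n using Nat.strong_induction_on with
  | _ n ih =>
  rcases le_or_gt n L with hn | hn
  · refine (kraftOn_uniform n).mono subset_rfl fun x _ => ?_
    have h2 : (n : ℝ) * Real.log k ≤ L * Real.log k := by gcongr
    have := hS0 n x
    linarith
  set C : ℕ → X → ℝ := fun n x => birkhoffSum T h n x + L * Real.log k with hC
  refine KraftOn.mixture (Finset.insertNone F)
    (fun o => o.elim (1 / 2) fun p => Real.exp (-s * len p))
    (fun o => o.elim univ U)
    (fun o => o.elim (fun x => (1 : ℕ) * Real.log (Fintype.card ι) + C (n - 1) (T^[1] x))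
      fun p x => birkhoffSum T g (len p) x + C (n - len p) (T^[len p] x)) ?_ ?_ ?_ ?_
  · rintro (_ | p) _
    · simp
    · exact (Real.exp_pos _).le
  · rw [Finset.sum_insertNone]
    simp only [Option.elim]
    linarith
  · rintro (_ | p) hp
    · have := (kraftOn_uniform (T := T) (P := P) 1).append_univ (ih (n - 1) (by lia))
      rwa [show 1 + (n - 1) = n by lia] at this
    · rw [Finset.some_mem_insertNone] at hp
      have := (hK p hp).append (ih (n - len p) (by have := h1 p hp; lia))
      rw [show len p + (n - len p) = n by have := hL p hp; lia] at this
      exact this.mono (by simp) fun _ _ => le_rfl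
  · intro x _
    by_cases hx : x ∈ Bad
    · refine ⟨none, by simp, mem_univ _, ?_⟩
      simp only [Option.elim, hC]
      obtain ⟨m, rfl⟩ : ∃ m, n = 1 + m := ⟨n - 1, by lia⟩
      rw [birkhoffSum_add, birkhoffSum_one, Nat.add_sub_cancel_left]
      have e1 : s + g x + Real.log (2 * k) = h x := by simp [hh, hx]
      have := hg x
      have e2 : (1 / 2 : ℝ) = Real.exp (-Real.log 2) := by
        rw [Real.exp_neg, Real.exp_log (by norm_num)]
        norm_num
      rw [e2, ← Real.exp_add, Real.exp_le_exp, ← e1, Real.log_mul (by norm_num) (by linarith),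
        ← hk]
      push_cast
      linarith
    · have : ∃ p ∈ F, x ∈ U p := by simpa [hBad] using hx
      obtain ⟨p, hp, hxp⟩ := this
      refine ⟨some p, by simpa using hp, hxp, ?_⟩
      simp only [Option.elim, hC]
      obtain ⟨m, hm⟩ : ∃ m, n = len p + m := ⟨n - len p, by have := hL p hp; lia⟩
      rw [hm, birkhoffSum_add, Nat.add_sub_cancel_left, ← Real.exp_add, Real.exp_le_exp]
      have : s * len p + birkhoffSum T g (len p) x ≤ birkhoffSum T h (len p) x := by
        have := Finset.sum_le_sum (s := Finset.range (len p)) fun j _ => hgh (T^[j] x)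
        rw [Finset.sum_add_distrib, Finset.sum_const, Finset.card_range, nsmul_eq_mul] at this
        simp only [birkhoffSum]
        linarith
      linarith

theorem integral_birkhoffSum [MeasurableSpace X] {μ : Measure X} (hT : MeasurePreserving T μ μ)
    {h : X → ℝ} (hm : Measurable h) (hi : Integrable h μ) (n : ℕ) :
    Integrable (birkhoffSum T h n) μ ∧ ∫ x, birkhoffSum T h n x ∂μ = n * ∫ x, h x ∂μ := by
  have hj : ∀ j, Integrable (fun x => h (T^[j] x)) μ := fun j =>
    (hT.iterate j).integrable_comp_of_integrable hi
  refine ⟨integrable_finsetSum _ fun j _ => hj j, ?_⟩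
  simp only [birkhoffSum]
  rw [integral_finsetSum _ fun j _ => hj j]
  have : ∀ j, ∫ x, h (T^[j] x) ∂μ = ∫ x, h x ∂μ := fun j => by
    rw [← integral_map (hT.iterate j).measurable.aemeasurable hm.aestronglyMeasurable,
      (hT.iterate j).map_eq]
  simp [this]

theorem limsup_partEnt_le [MeasurableSpace X] [MeasurableSpace ι] [MeasurableSingletonClass ι]
    {μ : Measure X} [IsProbabilityMeasure μ] (hT : MeasurePreserving T μ μ) (hP : Measurable P)
    {h : X → ℝ} (hm : Measurable h) (hi : Integrable h μ) (C : ℝ)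
    (hK : ∀ n, KraftOn T P univ n (fun x => birkhoffSum T h n x + C)) :
    limsup (fun n : ℕ => ENNReal.ofReal (partEnt μ (itinerary T P n) / n)) atTop ≤
      ENNReal.ofReal (∫ x, h x ∂μ) := by
  have hle : ∀ n : ℕ, partEnt μ (itinerary T P n) ≤ n * ∫ x, h x ∂μ + C := fun n => by
    obtain ⟨hi', he⟩ := integral_birkhoffSum hT hm hi n
    refine ((hK n).partEnt_le hT.measurable hP (hi'.add (integrable_const C))).trans_eq ?_
    rw [integral_add hi' (integrable_const C), he]
    simp
  have hlim : Tendsto (fun n : ℕ => ENNReal.ofReal (∫ x, h x ∂μ + C / n)) atTop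
      (𝓝 (ENNReal.ofReal (∫ x, h x ∂μ))) := by
    refine ENNReal.tendsto_ofReal ?_
    simpa using tendsto_const_nhds.add (tendsto_const_div_atTop_nhds_zero_nat C)
  rw [← hlim.limsup_eq]
  refine limsup_le_limsup ?_
  filter_upwards [eventually_gt_atTop 0] with n hn
  have hn' : (0 : ℝ) < n := by exact_mod_cast hn
  refine ENNReal.ofReal_le_ofReal ?_
  rw [div_le_iff₀ hn', add_mul, div_mul_cancel₀ _ hn'.ne', mul_comm]
  exact hle n

theorem isOpen_bowenBallMap [PseudoMetricSpace X] (hT : Continuous T) (x : X) (n : ℕ) (ε : ℝ) :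
    IsOpen (bowenBallMap T x n ε) := by
  have : bowenBallMap T x n ε = ⋂ j ∈ Finset.range n, {y | dist (T^[j] x) (T^[j] y) < ε} := by
    ext y
    simp [bowenBallMap]
  rw [this]
  exact isOpen_biInter_finset fun j _ =>
    isOpen_lt (continuous_const.dist (hT.iterate j)) continuous_const

/-- Any conull set `Z` with `M^s(T, Z) = 0` has a finite family of Bowen balls of small weight
whose union has almost full measure. -/
theorem exists_finset_bowenBallMap [PseudoMetricSpace X] [MeasurableSpace X] [BorelSpace X]
    {μ : Measure X} [IsProbabilityMeasure μ] (hT : Continuous T) {Z : Set X}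
    (hZ : ∀ᵐ x ∂μ, x ∈ Z) {s : ℝ} (hM : coverMMapLim T Z s = 0) {ε : ℝ} (hε : 0 < ε) {θ : ℝ}
    (hθ : 0 < θ) :
    ∃ F : Finset (X × ℕ), (∀ p ∈ F, 1 ≤ p.2) ∧ ∑ p ∈ F, Real.exp (-s * p.2) ≤ 1 / 2 ∧
      μ.real (⋃ p ∈ F, bowenBallMap T p.1 p.2 ε)ᶜ ≤ θ := by
  have h0 : coverMMap T Z s 1 ε = 0 := by
    have h1 : coverMMapEps T Z s ε ≤ 0 := hM ▸ le_iSup₂ (f := fun (ε : ℝ) (_ : 0 < ε) =>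
      coverMMapEps T Z s ε) ε hε
    exact le_antisymm ((le_iSup (fun N => coverMMap T Z s N ε) 1).trans h1) zero_le
  have h0' : coverMMap T Z s 1 ε < ENNReal.ofReal (1 / 2) := by simp [h0]
  simp only [coverMMap, iInf_lt_iff] at h0'
  obtain ⟨F, hFc, hF1, hFZ, hFs⟩ := h0'
  obtain ⟨z, hz⟩ := hZ.exists
  have hFne : F.Nonempty := by
    obtain ⟨p, hp, -⟩ := mem_iUnion₂.1 (hFZ hz)
    exact ⟨p, hp⟩
  obtain ⟨f, rfl⟩ := hFc.exists_eq_range hFne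
  set B : ℕ → Set X := fun i => bowenBallMap T (f i).1 (f i).2 ε with hB
  have hBm : ∀ i, MeasurableSet (B i) := fun i => (isOpen_bowenBallMap hT _ _ _).measurableSet
  have hBfull : μ (⋃ i, B i) = 1 := by
    rw [← mem_ae_iff_prob_eq_one (MeasurableSet.iUnion hBm)]
    filter_upwards [hZ] with x hx
    simpa using hFZ hx
  have hlim := tendsto_measure_iUnion_accumulate (μ := μ) (f := B)
  rw [hBfull] at hlim
  have hlim' : Tendsto (fun n => μ.real (accumulate B n)) atTop (𝓝 1) := by
    have := (ENNReal.tendsto_toReal ENNReal.one_ne_top).comp hlim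
    simpa [Function.comp_def, measureReal_def] using this
  obtain ⟨n, hn⟩ := (hlim'.eventually (lt_mem_nhds (show 1 - θ < 1 by linarith))).exists
  classical
  refine ⟨(Finset.range (n + 1)).image f, ?_, ?_, ?_⟩
  · intro p hp
    obtain ⟨i, -, rfl⟩ := Finset.mem_image.1 hp
    exact hF1 _ ⟨i, rfl⟩
  · have h1 : ∑ p ∈ (Finset.range (n + 1)).image f, ENNReal.ofReal (Real.exp (-s * p.2)) ≤
        ENNReal.ofReal (1 / 2) := by
      refine le_trans ?_ hFs.le
      rw [tsum_subtype (range f) fun p : X × ℕ => ENNReal.ofReal (Real.exp (-s * p.2))]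
      refine le_trans (Finset.sum_le_sum fun p hp => ?_) (ENNReal.sum_le_tsum _)
      obtain ⟨i, -, rfl⟩ := Finset.mem_image.1 hp
      rw [indicator_of_mem (mem_range_self i)]
    rwa [← ENNReal.ofReal_sum_of_nonneg fun _ _ => (Real.exp_pos _).le,
      ENNReal.ofReal_le_ofReal_iff (by norm_num)] at h1
  · have e : (⋃ p ∈ (Finset.range (n + 1)).image f, bowenBallMap T p.1 p.2 ε) =
        accumulate B n := by
      ext y
      simp [hB, accumulate]
    have hm : MeasurableSet (accumulate B n) :=
      MeasurableSet.iUnion fun i => MeasurableSet.iUnion fun _ => hBm i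
    rw [e, probReal_compl_eq_one_sub hm]
    linarith

/-- Closed sets approximating the cells of a finite partition are uniformly separated. -/
theorem exists_separated_approx [MetricSpace X] [CompactSpace X] [MeasurableSpace X]
    [BorelSpace X] [MeasurableSpace ι] [MeasurableSingletonClass ι]
    {μ : Measure X} [IsProbabilityMeasure μ] (hP : Measurable P) {θ : ℝ} (hθ : 0 < θ) :
    ∃ K : Set X, MeasurableSet K ∧ μ.real Kᶜ ≤ θ ∧ ∃ ε > 0, ∀ x ∈ K, ∀ y ∈ K,
      dist x y < ε → P x = P y := by
  have hN : (0 : ℝ) < Fintype.card ι + 1 := by positivity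
  have hex : ∀ i : ι, ∃ F ⊆ P ⁻¹' {i}, IsClosed F ∧
      μ (P ⁻¹' {i} \ F) < ENNReal.ofReal (θ / (Fintype.card ι + 1)) := fun i =>
    (hP (measurableSet_singleton i)).exists_isClosed_sdiff_lt (measure_ne_top _ _)
      (by simpa using div_pos hθ hN)
  choose F hFs hFc hFm using hex
  refine ⟨⋃ i, F i, MeasurableSet.iUnion fun i => (hFc i).measurableSet, ?_, ?_⟩
  · have hsub : (⋃ i, F i)ᶜ ⊆ ⋃ i, (P ⁻¹' {i} \ F i) := by
      intro x hx
      refine mem_iUnion.2 ⟨P x, rfl, fun h => hx (mem_iUnion.2 ⟨_, h⟩)⟩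
    refine (measureReal_mono hsub).trans ((measureReal_iUnion_fintype_le _).trans ?_)
    refine (Finset.sum_le_sum (g := fun _ => θ / (Fintype.card ι + 1)) fun i _ => ?_).trans ?_
    · exact ENNReal.toReal_le_of_le_ofReal (by positivity) (hFm i).le
    · rw [Finset.sum_const, Finset.card_univ, nsmul_eq_mul, mul_div_assoc', div_le_iff₀ hN]
      linarith
  · have hsep : ∀ i j, i ≠ j → ∃ r : ℝ, 0 < r ∧ ∀ x ∈ F i, ∀ y ∈ F j, r < dist x y := by
      intro i j hij
      obtain ⟨r, hr, h⟩ := Metric.exists_pos_forall_lt_edist (hFc i).isCompact (hFc j)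
        (Disjoint.mono (hFs i) (hFs j) (Disjoint.preimage _ (by simpa using hij)))
      refine ⟨r, hr, fun x hx y hy => ?_⟩
      have := h x hx y hy
      rw [edist_dist, ← ENNReal.ofReal_coe_nnreal] at this
      exact (ENNReal.ofReal_lt_ofReal_iff_of_nonneg r.2).1 this
    have hev : ∀ᶠ ε : ℝ in 𝓝[>] 0, ∀ i j, i ≠ j → ∀ x ∈ F i, ∀ y ∈ F j, ε < dist x y := by
      refine eventually_all.2 fun i => eventually_all.2 fun j => ?_
      by_cases hij : i = j
      · simp [hij]
      · obtain ⟨r, hr, h⟩ := hsep i j hij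
        filter_upwards [Ioo_mem_nhdsGT hr] with ε hε _ x hx y hy
        exact hε.2.trans (h x hx y hy)
    obtain ⟨ε, hε, hε0⟩ := (hev.and self_mem_nhdsWithin).exists
    refine ⟨ε, hε0, fun x hx y hy hxy => ?_⟩
    obtain ⟨i, hi⟩ := mem_iUnion.1 hx
    obtain ⟨j, hj⟩ := mem_iUnion.1 hy
    rw [show P x = i from hFs i hi, show P y = j from hFs j hj]
    by_contra hij
    exact (hε i j hij x hi y hj).not_gt hxy

theorem kolSinai_le_of_coverMMapLim_eq_zero [MetricSpace X] [CompactSpace X] [MeasurableSpace X]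
    [BorelSpace X] {μ : Measure X} [IsProbabilityMeasure μ] (hT : Continuous T)
    (hmp : MeasurePreserving T μ μ) {Z : Set X} (hZ : ∀ᵐ x ∂μ, x ∈ Z) {s : ℝ} (hs : 0 ≤ s)
    (hM : coverMMapLim T Z s = 0) : kolSinai μ T ≤ ENNReal.ofReal s := by
  refine iSup_le fun k => iSup_le fun P => iSup_le fun hP => ?_
  have hlim : Tendsto (fun η : ℝ => ENNReal.ofReal (s + 3 * η)) (𝓝[>] 0)
      (𝓝 (ENNReal.ofReal s)) := by
    exact tendsto_nhdsWithin_of_tendsto_nhds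
      ((ENNReal.continuous_ofReal.comp (by fun_prop)).tendsto' _ _ (by simp))
  refine ge_of_tendsto hlim ?_
  filter_upwards [self_mem_nhdsWithin] with η (hη : 0 < η)
  obtain ⟨x0, -⟩ := hZ.exists
  have : Nonempty (Fin k) := ⟨P x0⟩
  have hk1 : (1 : ℝ) ≤ Fintype.card (Fin k) := by
    exact_mod_cast Nat.succ_le_of_lt Fintype.card_pos
  have hlt : Real.exp (-η) < 1 := by simpa using hη
  set b : ℝ := Real.log (Fintype.card (Fin k)) - Real.log (1 - Real.exp (-η)) with hb
  set t : ℝ := Real.log (2 * Fintype.card (Fin k)) with ht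
  have hb0 : 0 ≤ b := by
    have h1 := Real.log_nonneg hk1
    have h2 := Real.log_nonpos (x := 1 - Real.exp (-η)) (by linarith)
      (by have := Real.exp_pos (-η); linarith)
    linarith
  have ht0 : 0 ≤ t := Real.log_nonneg (by linarith)
  obtain ⟨K, hKm, hKμ, ε, hε, hKε⟩ := exists_separated_approx (μ := μ) hP
    (θ := η / (b + 1)) (by positivity)
  obtain ⟨F, hF1, hFs, hFμ⟩ := exists_finset_bowenBallMap hT hZ hM (half_pos hε)
    (θ := η / (t + 1)) (by positivity)
  set g : X → ℝ := fun y => η + Kᶜ.indicator (fun _ => b) y with hg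
  have hone : ∀ x, KraftOn T P {y | dist x y < ε / 2} 1 g := by
    intro x
    by_cases h : ∃ y ∈ K, dist x y < ε / 2
    · obtain ⟨y, hy, hxy⟩ := h
      refine kraftOn_one hη (P y) fun z hz hzK => hKε _ hzK _ hy ?_
      have hz' : dist x z < ε / 2 := hz
      have := dist_triangle_left z y x
      linarith
    · refine kraftOn_one hη (P x) fun z hz hzK => absurd ⟨z, hzK, hz⟩ h
  have hg0 : ∀ x, 0 ≤ g x := fun x =>
    add_nonneg hη.le (indicator_nonneg (fun _ _ => hb0) x)
  set U : Set X := ⋃ p ∈ F, bowenBallMap T p.1 p.2 (ε / 2) with hU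
  have hUm : MeasurableSet U := Finset.measurableSet_biUnion _ fun p _ =>
    (isOpen_bowenBallMap hT _ _ _).measurableSet
  have hpar := kraftOn_parse (T := T) (P := P) F (fun p => p.2)
    (fun p => bowenBallMap T p.1 p.2 (ε / 2)) hg0 hs (L := F.sup fun p => p.2) hF1
    (fun p hp => Finset.le_sup (f := fun p : X × ℕ => p.2) hp) hFs
    (fun p _ => kraftOn_bowenBallMap hone p.2 p.1)
  have hi1 : Integrable (Kᶜ.indicator fun _ => b) μ := (integrable_const b).indicator hKm.compl
  have hi2 : Integrable (Uᶜ.indicator fun _ => t) μ := (integrable_const t).indicator hUm.compl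
  have hgm : Measurable g := measurable_const.add (measurable_const.indicator hKm.compl)
  have hgi : Integrable g μ := (integrable_const η).add hi1
  refine (limsup_partEnt_le hmp hP ((measurable_const.add hgm).add
    (measurable_const.indicator hUm.compl)) (((integrable_const s).add hgi).add hi2) _ hpar).trans
    (ENNReal.ofReal_le_ofReal ?_)
  have e1 : ∫ x, g x ∂μ = η + μ.real Kᶜ * b := by
    rw [hg, integral_add (integrable_const η) hi1, integral_indicator_const _ hKm.compl]
    simp
  simp only [Pi.add_apply]
  rw [integral_add (f := fun y => s + g y) ((integrable_const s).add hgi) hi2,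
    integral_add (integrable_const s) hgi, e1, integral_indicator_const _ hUm.compl]
  have h1 : μ.real Kᶜ * b ≤ η := by
    refine (mul_le_mul_of_nonneg_right hKμ hb0).trans ?_
    rw [div_mul_eq_mul_div, div_le_iff₀ (by positivity)]
    nlinarith
  have h2 : μ.real Uᶜ * t ≤ η := by
    refine (mul_le_mul_of_nonneg_right hFμ ht0).trans ?_
    rw [div_mul_eq_mul_div, div_le_iff₀ (by positivity)]
    nlinarith
  simp only [integral_const, probReal_univ, smul_eq_mul]
  linarith

end LowerBound

section UpperBound

theorem coverMMap_le_tsum [PseudoMetricSpace X] {T : X → X} {Z : Set X} {s : ℝ} {N : ℕ} {ε : ℝ}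
    {F : Set (X × ℕ)} (hF : F.Countable) (hN : ∀ p ∈ F, N ≤ p.2)
    (hZ : Z ⊆ ⋃ p ∈ F, bowenBallMap T p.1 p.2 ε) :
    coverMMap T Z s N ε ≤ ∑' p : F, ENNReal.ofReal (Real.exp (-s * ((p : X × ℕ).2 : ℝ))) := by
  rw [coverMMap]
  exact iInf_le_of_le F (iInf_le_of_le hF (iInf_le_of_le hN (iInf_le _ hZ)))

theorem coverMMap_iUnion_eq_zero [PseudoMetricSpace X] {T : X → X} {Z : ℕ → Set X} {s : ℝ}
    {N : ℕ} {ε : ℝ} (h : ∀ i, coverMMap T (Z i) s N ε = 0) :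
    coverMMap T (⋃ i, Z i) s N ε = 0 := by
  refine le_antisymm (ENNReal.le_of_forall_pos_le_add fun δ hδ _ => ?_) zero_le
  obtain ⟨δ', hδ', hsum⟩ := ENNReal.exists_pos_sum_of_countable
    (ENNReal.coe_ne_zero.2 hδ.ne') ℕ
  have hex : ∀ i, ∃ F : Set (X × ℕ), F.Countable ∧ (∀ p ∈ F, N ≤ p.2) ∧
      (Z i ⊆ ⋃ p ∈ F, bowenBallMap T p.1 p.2 ε) ∧
      ∑' p : F, ENNReal.ofReal (Real.exp (-s * ((p : X × ℕ).2 : ℝ))) < δ' i := by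
    intro i
    have h' : coverMMap T (Z i) s N ε < δ' i := by
      rw [h i]
      exact_mod_cast hδ' i
    simpa only [coverMMap, iInf_lt_iff, exists_prop] using h'
  choose F hF1 hF2 hF3 hF4 using hex
  rw [zero_add]
  refine (coverMMap_le_tsum (F := ⋃ i, F i) (countable_iUnion hF1) (fun p hp => ?_)
    (iUnion_subset fun i => (hF3 i).trans
      (biUnion_subset_biUnion_left (subset_iUnion F i)))).trans
    ((ENNReal.tsum_iUnion_le_tsum
      (fun p : X × ℕ => ENNReal.ofReal (Real.exp (-s * (p.2 : ℝ)))) F).trans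
      ((ENNReal.tsum_le_tsum fun i => (hF4 i).le).trans hsum.le))
  obtain ⟨i, hi⟩ := mem_iUnion.1 hp
  exact hF2 i p hi

theorem coverMMap_mono [PseudoMetricSpace X] {T : X → X} {Z Z' : Set X} (hZ : Z ⊆ Z') {s : ℝ}
    {N : ℕ} {ε : ℝ} : coverMMap T Z s N ε ≤ coverMMap T Z' s N ε :=
  iInf_mono fun _ => iInf_mono fun _ => iInf_mono fun _ => le_iInf fun h => iInf_le_of_le
    (hZ.trans h) le_rfl

/-- A Kraft inequality on `Y` for a fine partition bounds the cost of covering `Y`. -/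
theorem KraftOn.coverMMap_le [PseudoMetricSpace X] {ι : Type*} [Fintype ι] {T : X → X} {P : X → ι}
    {ε : ℝ} (hP : ∀ x y, P x = P y → dist x y < ε) {n n' : ℕ} (hn : n ≤ n') {c : X → ℝ}
    {Y : Set X} (h : KraftOn T P Y n' c) {b : ℝ} (hb : ∀ x ∈ Y, c x ≤ b) {N : ℕ} (hN : N ≤ n)
    (s : ℝ) : coverMMap T Y s N ε ≤ ENNReal.ofReal (Real.exp (b - s * n)) := by
  classical
  set A : Finset (Fin n' → ι) := Finset.univ.filter fun u => ∃ x ∈ Y, itinerary T P n' x = u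
    with hA
  have hex : ∀ u ∈ A, ∃ x ∈ Y, itinerary T P n' x = u := fun u hu => (Finset.mem_filter.1 hu).2
  have hcard := h.card_le hb A hex
  choose z hz using hex
  set F : Finset (X × ℕ) := A.attach.image fun u => (z u.1 u.2, n) with hF
  have hF2 : ∀ p ∈ F, p.2 = n := by
    intro p hp
    obtain ⟨u, -, rfl⟩ := Finset.mem_image.1 hp
    rfl
  refine (coverMMap_le_tsum (F := (F : Set (X × ℕ))) F.countable_toSet (fun p hp => ?_)
    (fun y hy => ?_)).trans ?_
  · rw [hF2 p hp]
    exact hN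
  · have hu : itinerary T P n' y ∈ A := by simpa [hA] using ⟨y, hy, rfl⟩
    refine mem_iUnion₂.2 ⟨(z _ hu, n), ?_, fun j hj => hP _ _ ?_⟩
    · exact Finset.mem_coe.2 (Finset.mem_image.2 ⟨⟨_, hu⟩, Finset.mem_attach _ _, rfl⟩)
    · exact congrFun (hz _ hu).2 (⟨j, hj.trans_le hn⟩ : Fin n')
  · have e : ∑' p : (F : Set (X × ℕ)), ENNReal.ofReal (Real.exp (-s * ((p : X × ℕ).2 : ℝ))) =
        ∑ p ∈ F, ENNReal.ofReal (Real.exp (-s * (p.2 : ℝ))) :=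
      Finset.tsum_subtype F fun p : X × ℕ => ENNReal.ofReal (Real.exp (-s * (p.2 : ℝ)))
    rw [e, ← ENNReal.ofReal_sum_of_nonneg fun _ _ => (Real.exp_pos _).le]
    refine ENNReal.ofReal_le_ofReal ?_
    rw [Finset.sum_congr rfl fun p hp => by rw [hF2 p hp], Finset.sum_const, nsmul_eq_mul,
      sub_eq_add_neg, Real.exp_add, neg_mul]
    refine mul_le_mul_of_nonneg_right (le_trans ?_ hcard) (Real.exp_pos _).le
    exact_mod_cast Finset.card_image_le.trans_eq A.card_attach

/-- The canonical code of the `P`-names of length `q`. -/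
theorem exists_kraftOn_partEnt {ι : Type*} [Fintype ι] [Nonempty ι] [MeasurableSpace X]
    [MeasurableSpace ι]
    [MeasurableSingletonClass ι] {T : X → X} {P : X → ι} {μ : Measure X} [IsProbabilityMeasure μ]
    (hT : Measurable T) (hP : Measurable P) (q : ℕ) :
    ∃ w : (Fin q → ι) → ℝ, (∀ u, 0 ≤ w u) ∧
      KraftOn T P univ q (fun x => w (itinerary T P q x)) ∧
      ∑ u, w u * μ.real (itinerary T P q ⁻¹' {u}) = partEnt μ (itinerary T P q) + Real.log 2 := by
  classical
  set p : (Fin q → ι) → ℝ := fun u => μ.real (itinerary T P q ⁻¹' {u}) with hp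
  have hsum : ∑ u, p u = 1 := by
    have := partEnt_eq_integral (μ := μ) (measurable_itinerary (n := q) hT hP) (fun _ => 1)
    simpa [hp, measureReal_def] using this.symm
  set M : ℝ := (Fintype.card (Fin q → ι) : ℝ) with hM
  have hM1 : 1 ≤ M := by
    rw [hM]
    exact_mod_cast Nat.succ_le_of_lt Fintype.card_pos
  set p' : (Fin q → ι) → ℝ := fun u => if p u = 0 then M⁻¹ else p u with hp'
  have hp'0 : ∀ u, 0 < p' u := fun u => by
    simp only [hp']
    split_ifs with h
    · positivity
    · exact lt_of_le_of_ne measureReal_nonneg (Ne.symm h)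
  have hp'1 : ∀ u, p' u ≤ 1 := fun u => by
    simp only [hp']
    split_ifs with h
    · exact inv_le_one_of_one_le₀ hM1
    · exact measureReal_le_one
  have hp's : ∑ u, p' u ≤ 2 := by
    have h1 : ∀ u, p' u ≤ M⁻¹ + p u := fun u => by
      simp only [hp']
      split_ifs with h
      · simp [h]
      · have : 0 < M⁻¹ := by positivity
        linarith
    refine (Finset.sum_le_sum fun u _ => h1 u).trans ?_
    rw [Finset.sum_add_distrib, hsum, Finset.sum_const, Finset.card_univ, nsmul_eq_mul,
      mul_inv_cancel₀ (by positivity)]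
    norm_num
  refine ⟨fun u => Real.log 2 - Real.log (p' u), fun u => ?_, ⟨fun u => p' u / 2, fun u => ?_,
    ?_, fun x _ => ?_⟩, ?_⟩
  · have := Real.log_nonpos (hp'0 u).le (hp'1 u)
    have := Real.log_pos (show (1 : ℝ) < 2 by norm_num)
    simp only
    linarith
  · have := hp'0 u
    positivity
  · rw [← Finset.sum_div]
    linarith
  · rw [neg_sub, Real.exp_sub, Real.exp_log (hp'0 _), Real.exp_log (by norm_num)]
  · have h1 : ∀ u, (Real.log 2 - Real.log (p' u)) * p u =
        Real.negMulLog (p u) + Real.log 2 * p u := fun u => by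
      simp only [hp', Real.negMulLog]
      split_ifs with h
      · simp [h]
      · ring
    rw [Finset.sum_congr rfl fun u _ => h1 u, Finset.sum_add_distrib, ← Finset.mul_sum, hsum,
      mul_one]
    rfl

/-- A step function with null frontiers has continuous majorants of almost the same integral. -/
theorem exists_continuousMap_ge [MetricSpace X] [CompactSpace X] [MeasurableSpace X]
    [BorelSpace X] {μ : Measure X} [IsProbabilityMeasure μ] {κ : Type*} [Fintype κ] {Q : X → κ}
    (hQ : ∀ u, μ (frontier (Q ⁻¹' {u})) = 0) {w : κ → ℝ} (hw : ∀ u, 0 ≤ w u) {η : ℝ}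
    (hη : 0 < η) :
    ∃ f : C(X, ℝ), (∀ x, w (Q x) ≤ f x) ∧
      ∫ x, f x ∂μ ≤ ∑ u, w u * μ.real (Q ⁻¹' {u}) + η := by
  set A : κ → Set X := fun u => closure (Q ⁻¹' {u}) with hA
  have hAμ : ∀ u, μ.real (A u) = μ.real (Q ⁻¹' {u}) := fun u =>
    measureReal_congr (closure_ae_eq_of_null_frontier (hQ u))
  have hpos : ∀ n : ℕ, (0 : ℝ) < 1 / (n + 1) := fun n => by positivity
  have hlim : Tendsto (fun n : ℕ => ∑ u, w u *
      ∫ x, (thickenedIndicator (hpos n) (A u) x : ℝ) ∂μ) atTop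
      (𝓝 (∑ u, w u * μ.real (Q ⁻¹' {u}))) := by
    refine tendsto_finsetSum _ fun u _ => Tendsto.const_mul _ ?_
    rw [← hAμ]
    exact tendsto_integral_thickenedIndicator_of_isClosed μ isClosed_closure hpos
      tendsto_one_div_add_atTop_nhds_zero_nat
  obtain ⟨n, hn⟩ := (hlim.eventually (gt_mem_nhds (lt_add_of_pos_right _ hη))).exists
  have hc : ∀ u, Continuous fun x => (thickenedIndicator (hpos n) (A u) x : ℝ) := fun u =>
    NNReal.continuous_coe.comp (thickenedIndicator (hpos n) (A u)).continuous
  refine ⟨⟨fun x => ∑ u, w u * (thickenedIndicator (hpos n) (A u) x : ℝ),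
    continuous_finsetSum _ fun u _ => continuous_const.mul (hc u)⟩, fun x => ?_, ?_⟩
  · have h1 : thickenedIndicator (hpos n) (A (Q x)) x = 1 :=
      thickenedIndicator_one (hpos n) _ (subset_closure rfl)
    refine le_trans ?_ (Finset.single_le_sum
      (f := fun u => w u * (thickenedIndicator (hpos n) (A u) x : ℝ))
      (fun u _ => mul_nonneg (hw u) (NNReal.coe_nonneg _)) (Finset.mem_univ (Q x)))
    rw [h1, NNReal.coe_one, mul_one]
  · simp only [ContinuousMap.coe_mk]
    rw [integral_finsetSum]
    · simp only [integral_const_mul]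
      exact hn.le
    · exact fun u _ => ((hc u).integrable_of_hasCompactSupport
        (HasCompactSupport.of_compactSpace _)).const_mul _

theorem frontier_itinerary_preimage [MetricSpace X] [MeasurableSpace X] [BorelSpace X]
    {ι : Type*} {μ : Measure X} {T : X → X} (hT : Continuous T) (hmp : MeasurePreserving T μ μ)
    {P : X → ι} (hP : ∀ i, μ (frontier (P ⁻¹' {i})) = 0) (n : ℕ) (u : Fin n → ι) :
    μ (frontier (itinerary T P n ⁻¹' {u})) = 0 := by
  have e : itinerary T P n ⁻¹' {u} = ⋂ j : Fin n, T^[j] ⁻¹' (P ⁻¹' {u j}) := by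
    ext x
    simp [itinerary, funext_iff]
  have hsub : frontier (⋂ j : Fin n, T^[j] ⁻¹' (P ⁻¹' {u j})) ⊆
      ⋃ j : Fin n, T^[j] ⁻¹' frontier (P ⁻¹' {u j}) := by
    intro x hx
    rw [frontier, interior_iInter_of_finite, Set.mem_sdiff, mem_iInter, not_forall] at hx
    obtain ⟨h1, j, hj⟩ := hx
    refine mem_iUnion.2 ⟨j, (hT.iterate j).frontier_preimage_subset _ ⟨?_, hj⟩⟩
    exact closure_mono (iInter_subset _ j) h1
  rw [e]
  refine measure_mono_null hsub (measure_iUnion_null fun j => ?_)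
  rw [(hmp.iterate j).measure_preimage measurableSet_frontier.nullMeasurableSet]
  exact hP _

/-- Every probability measure on a compact space admits arbitrarily fine finite partitions
whose cells have null frontier. -/
theorem exists_partition_null_frontier [MetricSpace X] [CompactSpace X] [MeasurableSpace X]
    [BorelSpace X] (μ : Measure X) [IsProbabilityMeasure μ] {ε : ℝ} (hε : 0 < ε) :
    ∃ (k : ℕ) (P : X → Fin k), Measurable P ∧ (∀ x y, P x = P y → dist x y < ε) ∧
      ∀ i, μ (frontier (P ⁻¹' {i})) = 0 := by
  have hex : ∀ x : X, ∃ r ∈ Ioo 0 (ε / 2), μ (frontier (Metric.ball x r)) = 0 := fun x => by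
    simpa using exists_null_frontier_thickening μ {x} (half_pos hε)
  choose r hr hrμ using hex
  obtain ⟨t, ht⟩ := isCompact_univ.elim_finite_subcover (fun x => Metric.ball x (r x))
    (fun x => Metric.isOpen_ball) fun x _ => mem_iUnion.2 ⟨x, Metric.mem_ball_self (hr x).1⟩
  set e := t.equivFin
  set k := t.card
  set B : Fin k → Set X := fun i => Metric.ball (e.symm i) (r (e.symm i)) with hB
  have hcov : ∀ x, ∃ i, x ∈ B i := fun x => by
    obtain ⟨y, hy, hxy⟩ := mem_iUnion₂.1 (ht (mem_univ x))
    exact ⟨e ⟨y, hy⟩, by simpa [hB] using hxy⟩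
  classical
  set P : X → Fin k := fun x => Fin.find (fun i => x ∈ B i) (hcov x) with hPdef
  have hPmem : ∀ x, x ∈ B (P x) := fun x => Fin.find_spec (hcov x)
  have hpre : ∀ i, P ⁻¹' {i} = B i ∩ ⋂ j : {j // j < i}, (B j)ᶜ := by
    intro i
    ext x
    simp only [mem_preimage, mem_singleton_iff, hPdef, Fin.find_eq_iff, mem_inter_iff, mem_iInter,
      mem_compl_iff, Subtype.forall]
  refine ⟨k, P, measurable_to_countable' fun i => ?_, fun x y hxy => ?_, fun i => ?_⟩
  · rw [hpre]
    exact Metric.isOpen_ball.measurableSet.inter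
      (MeasurableSet.iInter fun j => Metric.isOpen_ball.measurableSet.compl)
  · have h1 : dist x _ < _ := hPmem x
    have h2 : dist y _ < _ := hPmem y
    rw [← hxy] at h2
    have := dist_triangle_right x y (e.symm (P x) : X)
    have := (hr (e.symm (P x))).2
    linarith
  · rw [hpre]
    refine measure_mono_null (t := ⋃ j, frontier (B j)) ?_ (measure_iUnion_null fun j => hrμ _)
    refine (frontier_inter_subset _ _).trans (union_subset
      (inter_subset_left.trans (subset_iUnion (fun j => frontier (B j)) i)) ?_)
    refine inter_subset_right.trans fun x hx => ?_
    rw [frontier, interior_iInter_of_finite, Set.mem_sdiff, mem_iInter, not_forall] at hx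
    obtain ⟨h1, j, hj⟩ := hx
    refine mem_iUnion.2 ⟨j, ?_⟩
    rw [← frontier_compl]
    exact ⟨closure_mono (iInter_subset _ j) h1, hj⟩

theorem coverMMapLim_genericPtsMap_eq_zero [MetricSpace X] [CompactSpace X] [MeasurableSpace X]
    [BorelSpace X] {T : X → X} {μ : Measure X} [IsProbabilityMeasure μ] (hT : Continuous T)
    (hmp : MeasurePreserving T μ μ) {s : ℝ} (h : kolSinai μ T < ENNReal.ofReal s) :
    coverMMapLim T (genericPtsMap T μ) s = 0 := by
  refine le_antisymm (iSup₂_le fun ε hε => iSup_le fun N => le_of_eq ?_) zero_le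
  obtain ⟨k, P, hPm, hPε, hPμ⟩ := exists_partition_null_frontier μ hε
  obtain ⟨x0⟩ : Nonempty X := nonempty_of_isProbabilityMeasure μ
  have : Nonempty (Fin k) := ⟨P x0⟩
  obtain ⟨a, ha0, ha, has⟩ := ENNReal.lt_iff_exists_real_btwn.1 h
  rw [ENNReal.ofReal_lt_ofReal_iff_of_nonneg ha0] at has
  have hlimsup : limsup (fun n : ℕ => ENNReal.ofReal (partEnt μ (itinerary T P n) / n)) atTop <
      ENNReal.ofReal a := by
    have hle : limsup (fun n : ℕ => ENNReal.ofReal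
        (partEnt μ (fun x => fun j : Fin n => P (T^[(j : ℕ)] x)) / n)) atTop ≤ kolSinai μ T := by
      rw [kolSinai]
      exact le_iSup_of_le k (le_iSup_of_le P (le_iSup_of_le hPm le_rfl))
    exact lt_of_le_of_lt hle ha
  have hev := eventually_lt_of_limsup_lt hlimsup
  have hlim : Tendsto (fun q : ℕ => a + (Real.log 2 + 2) / q) atTop (𝓝 a) := by
    simpa using tendsto_const_nhds.add (tendsto_const_div_atTop_nhds_zero_nat (Real.log 2 + 2))
  obtain ⟨q, hq1, hq2, hq0⟩ :=
    (hev.and ((hlim.eventually (gt_mem_nhds has)).and (eventually_gt_atTop 0))).exists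
  have hq0' : (0 : ℝ) < q := by exact_mod_cast hq0
  have hH : partEnt μ (itinerary T P q) < a * q := by
    rw [← div_lt_iff₀ hq0']
    exact (ENNReal.ofReal_lt_ofReal_iff').1 hq1 |>.1
  obtain ⟨w, hw0, hwK, hwsum⟩ := exists_kraftOn_partEnt (μ := μ) hT.measurable hPm q
  obtain ⟨f, hf1, hf2⟩ := exists_continuousMap_ge
    (frontier_itinerary_preimage hT hmp hPμ q) hw0 one_pos
  rw [hwsum] at hf2
  set I : ℝ := ∫ x, f x ∂μ with hI
  have hIs : I + 1 < s * q := by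
    have := mul_lt_mul_of_pos_right hq2 hq0'
    rw [add_mul, div_mul_cancel₀ _ hq0'.ne'] at this
    linarith
  set Z : ℕ → Set X := fun M => {x | ∀ n, M ≤ n → birkhoffSum T f n x ≤ n * (I + 1)} with hZ
  have hGZ : genericPtsMap T μ ⊆ ⋃ M, Z M := by
    intro x hx
    obtain ⟨M, hM⟩ := eventually_atTop.1 (((hx f).eventually
      (gt_mem_nhds (lt_add_one I))).and (eventually_gt_atTop 0))
    refine mem_iUnion.2 ⟨M, fun n hn => ?_⟩
    obtain ⟨h1, h2⟩ := hM n hn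
    have h2' : (0 : ℝ) < n := by exact_mod_cast h2
    rw [one_div, inv_mul_lt_iff₀ h2'] at h1
    exact h1.le
  refine le_antisymm ((coverMMap_mono hGZ).trans_eq (coverMMap_iUnion_eq_zero fun M => ?_)) zero_le
  have hbound : ∀ m, max M N ≤ m → coverMMap T (Z M) s N ε ≤ ENNReal.ofReal (Real.exp
      (q * Real.log (Fintype.card (Fin k)) + m * (I + 1 - s * q))) := by
    intro m hm
    have hqm : m ≤ q * m := Nat.le_mul_of_pos_left _ hq0
    refine (KraftOn.coverMMap_le hPε (Nat.le_add_right (q * m) q)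
      ((hwK.birkhoffSum hq0 m).mono (subset_univ (Z M)) fun _ _ => le_rfl) (b := q *
        Real.log (Fintype.card (Fin k)) + m * (I + 1)) (fun x hx => ?_) (N := N)
        (by lia) s).trans_eq ?_
    · have h1 := hx (q * m) (by lia)
      have h2 : birkhoffSum T (fun x => w (itinerary T P q x)) (q * m) x ≤
          birkhoffSum T f (q * m) x := Finset.sum_le_sum fun j _ => hf1 _
      have h3 := h2.trans h1
      push_cast at h3
      rw [add_le_add_iff_left, inv_mul_le_iff₀ hq0']
      linarith
    · push_cast
      ring_nf
  have hlim0 : Tendsto (fun m : ℕ => ENNReal.ofReal (Real.exp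
      (q * Real.log (Fintype.card (Fin k)) + m * (I + 1 - s * q)))) atTop (𝓝 0) := by
    rw [← ENNReal.ofReal_zero]
    refine ENNReal.tendsto_ofReal (Real.tendsto_exp_atBot.comp ?_)
    exact tendsto_atBot_add_const_left _ _
      (tendsto_natCast_atTop_atTop.atTop_mul_const_of_neg (by linarith))
  refine le_antisymm (ge_of_tendsto hlim0 ?_) zero_le
  filter_upwards [eventually_ge_atTop (max M N)] with m hm using hbound m hm

end UpperBound

/-- **Bowen (1973).** For a continuous map `T` on a compact metric space and an ergodic
`T`-invariant Borel probability measure `μ`, the Bowen (dimension-like) topological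
entropy of the set of generic points of `μ` equals `h_μ(T)`. -/
theorem bowen_genericPts_map {X : Type*} [MetricSpace X] [CompactSpace X]
    [MeasurableSpace X] [BorelSpace X] (T : X → X) (hT : Continuous T)
    (μ : Measure X) [IsProbabilityMeasure μ] (herg : Ergodic T μ) :
    bowenEntropyMap T (genericPtsMap T μ) = kolSinai μ T := by
  apply le_antisymm
  · refine le_of_forall_gt fun c hc => ?_
    obtain ⟨s, hs, h₁, h₂⟩ := ENNReal.lt_iff_exists_real_btwn.1 hc
    refine lt_of_le_of_lt ?_ h₂
    rw [bowenEntropyMap]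
    exact iInf_le_of_le s (iInf_le_of_le hs (iInf_le_of_le
      (coverMMapLim_genericPtsMap_eq_zero hT herg.toMeasurePreserving h₁) le_rfl))
  · rw [bowenEntropyMap]
    exact le_iInf fun s => le_iInf fun hs => le_iInf fun hM =>
      kolSinai_le_of_coverMMapLim_eq_zero hT herg.toMeasurePreserving
        (ae_mem_genericPtsMap herg) hs hM

end FlowEntropy
end

section
/- Let (X,d) be a compact metric space, φ a continuous flow on X without fixed points, μ a φ-invariant Borel probability measure, τ>0, and L∈ℕ. Let μ = ∫_Y μ_y dπ(y) be the ergodic decomposition of μ with respect to the homeomorphism φ_{Lτ}, with h(y)=h_{μ_y}(φ_{Lτ}) the entropy of the ergodic component μ_y, and let X_∞ be the union of those ergodic components with h(y)=∞. Then for μ-almost every x∈X_∞, lim_{ε→0} liminf_{n→∞} −(1/(nLτ)) log μ(B(x,nLτ,ε,φ)) = ∞. -/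
open MeasureTheory Filter Set Topology
open scoped ENNReal NNReal

namespace FlowEntropy

variable {X : Type*}

/-- The `n`-itinerary of `x` under `f` with respect to the partition `Q`. -/
def itin {A : Type*} (f : X → X) (Q : X → A) (n : ℕ) (x : X) : Fin n → A :=
  fun j => Q (f^[(j : ℕ)] x)

/-- Extension of a finite word to an infinite sequence by a fixed letter. -/
noncomputable def extendWord {A : Type*} [Nonempty A] {N : ℕ} (w : Fin N → A) (i : ℕ) : A :=
  if h : i < N then w ⟨i, h⟩ else Classical.arbitrary A

lemma extendWord_of_lt {A : Type*} [Nonempty A] {N : ℕ} (w : Fin N → A) {i : ℕ} (h : i < N) :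
    extendWord w i = w ⟨i, h⟩ := dif_pos h

lemma extendWord_append_shift {A : Type*} [Nonempty A] {l m : ℕ} (u : Fin l → A)
    (v : Fin m → A) :
    (fun i => extendWord (Fin.append u v) (i + l)) = extendWord v := by
  funext i
  by_cases h : i < m
  · rw [extendWord_of_lt _ (by omega), extendWord_of_lt _ h]
    have : (⟨i + l, by omega⟩ : Fin (l + m)) = Fin.natAdd l ⟨i, h⟩ := by
      ext; simp [add_comm]
    rw [this, Fin.append_right]
  · simp only [extendWord]
    rw [dif_neg (by omega), dif_neg h]

lemma extendWord_append_left {A : Type*} [Nonempty A] {l m : ℕ} (u : Fin l → A)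
    (v : Fin m → A) {i : ℕ} (h : i < l) :
    extendWord (Fin.append u v) i = extendWord u i := by
  rw [extendWord_of_lt _ (by omega), extendWord_of_lt _ h]
  have : (⟨i, by omega⟩ : Fin (l + m)) = Fin.castAdd m ⟨i, h⟩ := by ext; simp
  rw [this, Fin.append_left]

/-- Summing a product of a function of the first `l` letters and a function of the remaining
letters. -/
lemma sum_extendWord_mul {A : Type*} [Fintype A] [Nonempty A] (l m : ℕ)
    (p G : (ℕ → A) → ℝ) (hp : ∀ ω ω' : ℕ → A, (∀ i < l, ω i = ω' i) → p ω = p ω') :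
    ∑ w : Fin (l + m) → A, p (extendWord w) * G (fun i => extendWord w (i + l)) =
      (∑ u : Fin l → A, p (extendWord u)) * ∑ v : Fin m → A, G (extendWord v) := by
  rw [← (Fin.appendEquiv l m).sum_comp, Fintype.sum_prod_type, Finset.sum_mul_sum]
  refine Finset.sum_congr rfl fun u _ => Finset.sum_congr rfl fun v _ => ?_
  simp only [Fin.appendEquiv, Equiv.coe_fn_mk]
  rw [extendWord_append_shift, hp _ (extendWord u) fun i hi => extendWord_append_left u v hi]

/-- A universal code: the weight of a word is the total weight of its parsings into single
letters (weight `1 / (2 |A|)`) and blocks of length `l` (weight `2 ^ (-(l + 1)) * p l`). -/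
noncomputable def codeWeight {A : Type*} [Fintype A] (p : ℕ → (ℕ → A) → ℝ) :
    ℕ → (ℕ → A) → ℝ
  | 0, _ => 1
  | N + 1, ω => (1 / (2 * Fintype.card A)) * codeWeight p N (fun i => ω (i + 1)) +
      ∑ j : Fin (N + 1), (1 / 2) ^ ((j : ℕ) + 2) *
        (p (j + 1) ω * codeWeight p (N - j) (fun i => ω (i + (j + 1))))
  termination_by N => N
  decreasing_by all_goals omega

section codeWeight

variable {A : Type*} [Fintype A] {p : ℕ → (ℕ → A) → ℝ}

lemma codeWeight_zero (ω : ℕ → A) : codeWeight p 0 ω = 1 := by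
  rw [codeWeight]

lemma codeWeight_succ (N : ℕ) (ω : ℕ → A) : codeWeight p (N + 1) ω =
    (1 / (2 * Fintype.card A)) * codeWeight p N (fun i => ω (i + 1)) +
      ∑ j : Fin (N + 1), (1 / 2) ^ ((j : ℕ) + 2) *
        (p (j + 1) ω * codeWeight p (N - j) (fun i => ω (i + (j + 1)))) := by
  rw [codeWeight]

lemma codeWeight_nonneg (hp : ∀ l ω, 0 ≤ p l ω) (N : ℕ) : ∀ ω, 0 ≤ codeWeight p N ω := by
  induction N using Nat.strong_induction_on with
  | _ N ih =>
    intro ω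
    cases N with
    | zero => rw [codeWeight_zero]; norm_num
    | succ N =>
      rw [codeWeight_succ]
      refine add_nonneg (mul_nonneg (by positivity) (ih N (by omega) _))
        (Finset.sum_nonneg fun j _ => mul_nonneg (by positivity)
          (mul_nonneg (hp _ _) (ih _ (by omega) _)))

lemma codeWeight_congr
    (hdep : ∀ l (ω ω' : ℕ → A), (∀ i < l, ω i = ω' i) → p l ω = p l ω') (N : ℕ) :
    ∀ ω ω' : ℕ → A, (∀ i < N, ω i = ω' i) → codeWeight p N ω = codeWeight p N ω' := by
  induction N using Nat.strong_induction_on with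
  | _ N ih =>
    intro ω ω' h
    cases N with
    | zero => rw [codeWeight_zero, codeWeight_zero]
    | succ N =>
      rw [codeWeight_succ, codeWeight_succ,
        ih N (by omega) _ _ fun i hi => h (i + 1) (by omega)]
      congr 1
      refine Finset.sum_congr rfl fun j _ => ?_
      rw [hdep (j + 1) ω ω' fun i hi => h i (by omega),
        ih (N - j) (by omega) _ _ fun i hi => h (i + (j + 1)) (by omega)]

lemma codeWeight_sum_le [Nonempty A] (hp : ∀ l ω, 0 ≤ p l ω)
    (hdep : ∀ l (ω ω' : ℕ → A), (∀ i < l, ω i = ω' i) → p l ω = p l ω')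
    (hsum : ∀ l, ∑ w : Fin l → A, p l (extendWord w) ≤ 1) (N : ℕ) :
    ∑ w : Fin N → A, codeWeight p N (extendWord w) ≤ 1 := by
  induction N using Nat.strong_induction_on with
  | _ N ih =>
    cases N with
    | zero => simp [codeWeight_zero]
    | succ N =>
      simp only [codeWeight_succ]
      rw [Finset.sum_add_distrib, ← Finset.mul_sum, Finset.sum_comm]
      have hcard : (0 : ℝ) < Fintype.card A := by exact_mod_cast Fintype.card_pos
      have h1 : ∑ w : Fin (N + 1) → A, codeWeight p N (fun i => extendWord w (i + 1)) ≤
          Fintype.card A := by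
        have := sum_extendWord_mul 1 N (fun _ => 1) (codeWeight p N) (fun _ _ _ => rfl)
        rw [Nat.add_comm 1 N] at this
        simp only [one_mul] at this
        rw [this]
        simp only [Finset.sum_const, Finset.card_univ, Fintype.card_pi, Finset.prod_const,
          Fintype.card_fin, pow_one, nsmul_eq_mul, mul_one]
        exact mul_le_of_le_one_right hcard.le (ih N (by omega))
      have h2 : ∀ j : Fin (N + 1), ∑ w : Fin (N + 1) → A, (1 / 2 : ℝ) ^ ((j : ℕ) + 2) *
          (p (j + 1) (extendWord w) *
            codeWeight p (N - j) (fun i => extendWord w (i + (j + 1)))) ≤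
          (1 / 2 : ℝ) ^ ((j : ℕ) + 2) := by
        intro j
        rw [← Finset.mul_sum]
        refine mul_le_of_le_one_right (by positivity) ?_
        have := sum_extendWord_mul (j + 1) (N - j) (p (j + 1)) (codeWeight p (N - j))
          (hdep (j + 1))
        rw [show (j : ℕ) + 1 + (N - j) = N + 1 by omega] at this
        rw [this]
        refine mul_le_one₀ (hsum _) (Finset.sum_nonneg fun _ _ => codeWeight_nonneg hp _ _)
          (ih _ (by omega))
      have h3 : ∑ j : Fin (N + 1), (1 / 2 : ℝ) ^ ((j : ℕ) + 2) ≤ 1 / 2 := by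
        rw [Fin.sum_univ_eq_sum_range (fun j => (1 / 2 : ℝ) ^ (j + 2)) (N + 1)]
        have : ∀ n : ℕ, ∑ j ∈ Finset.range n, (1 / 2 : ℝ) ^ (j + 2) =
            1 / 2 - (1 / 2) ^ (n + 1) := by
          intro n
          induction n with
          | zero => norm_num
          | succ n ihn => rw [Finset.sum_range_succ, ihn]; ring
        rw [this]
        have : (0 : ℝ) < (1 / 2) ^ (N + 1 + 1) := by positivity
        linarith
      calc _ ≤ 1 / (2 * (Fintype.card A : ℝ)) * Fintype.card A +
            ∑ j : Fin (N + 1), (1 / 2 : ℝ) ^ ((j : ℕ) + 2) :=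
            add_le_add (mul_le_mul_of_nonneg_left h1 (by positivity))
              (Finset.sum_le_sum fun j _ => h2 j)
        _ ≤ 1 / 2 + 1 / 2 := by
            refine add_le_add (le_of_eq ?_) h3
            field_simp
        _ = 1 := by norm_num

lemma codeWeight_letter_le (hp : ∀ l ω, 0 ≤ p l ω) (N : ℕ) (ω : ℕ → A) :
    (1 / (2 * Fintype.card A)) * codeWeight p N (fun i => ω (i + 1)) ≤
      codeWeight p (N + 1) ω := by
  rw [codeWeight_succ]
  exact le_add_of_nonneg_right (Finset.sum_nonneg fun j _ => mul_nonneg (by positivity)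
    (mul_nonneg (hp _ _) (codeWeight_nonneg hp _ _)))

lemma codeWeight_block_le (hp : ∀ l ω, 0 ≤ p l ω) (j m : ℕ) (ω : ℕ → A) :
    (1 / 2) ^ (j + 2) * (p (j + 1) ω * codeWeight p m (fun i => ω (i + (j + 1)))) ≤
      codeWeight p (m + (j + 1)) ω := by
  rw [← add_assoc, codeWeight_succ]
  refine le_trans ?_ (le_add_of_nonneg_left
    (mul_nonneg (by positivity) (codeWeight_nonneg hp _ _)))
  have := Finset.single_le_sum (f := fun i : Fin (m + j + 1) => (1 / 2 : ℝ) ^ ((i : ℕ) + 2) *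
        (p (i + 1) ω * codeWeight p (m + j - i) (fun n => ω (n + (i + 1)))))
        (fun i _ => mul_nonneg (by positivity)
          (mul_nonneg (hp _ _) (codeWeight_nonneg hp _ _)))
        (Finset.mem_univ (⟨j, by omega⟩ : Fin (m + j + 1)))
  simpa using this

end codeWeight

/-- Gibbs' inequality for a subprobability weight. -/
lemma partEnt_le_integral [MeasurableSpace X] (ν : Measure X) [IsProbabilityMeasure ν]
    {ι : Type*} [Fintype ι] (R : X → ι) (hR : ∀ i, MeasurableSet (R ⁻¹' {i})) (q : ι → ℝ)
    (hq : ∑ i, q i ≤ 1) (hq0 : ∀ i, 0 ≤ q i) (B : X → ℝ) (hB : Integrable B ν)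
    (hqB : ∀ x, Real.exp (-B x) ≤ q (R x)) :
    partEnt ν R ≤ ∫ x, B x ∂ν := by
  classical
  have hdisj : Pairwise (Function.onFun Disjoint fun i => R ⁻¹' {i}) := by
    intro i j hij
    exact Disjoint.preimage _ (by simpa using hij)
  have hun : (⋃ i, R ⁻¹' {i}) = univ := by ext; simp
  have h1 : ∫ x, B x ∂ν = ∑ i, ∫ x in R ⁻¹' {i}, B x ∂ν := by
    rw [← setIntegral_univ, ← hun]
    exact integral_iUnion_fintype hR hdisj fun i => hB.integrableOn
  have h2 : ∑ i, ν.real (R ⁻¹' {i}) = 1 := by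
    have := measureReal_iUnion_fintype (μ := ν) hdisj hR
    rw [hun] at this
    simpa using this.symm
  have key : ∀ i, Real.negMulLog (ν.real (R ⁻¹' {i})) ≤
      (∫ x in R ⁻¹' {i}, B x ∂ν) + (q i - ν.real (R ⁻¹' {i})) := by
    intro i
    rcases eq_or_lt_of_le (measureReal_nonneg (μ := ν) (s := R ⁻¹' {i})) with h0 | hpos
    · have : ν (R ⁻¹' {i}) = 0 := by
        rwa [eq_comm, measureReal_eq_zero_iff] at h0
      rw [← h0, Measure.restrict_eq_zero.2 this]
      simpa using hq0 i
    · obtain ⟨x0, hx0⟩ : (R ⁻¹' {i}).Nonempty := by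
        rw [nonempty_iff_ne_empty]
        rintro h
        rw [h] at hpos
        simp at hpos
      have hqpos : 0 < q i := by
        have := hqB x0
        rw [show R x0 = i from hx0] at this
        exact (Real.exp_pos _).trans_le this
      have hint : ν.real (R ⁻¹' {i}) * (-Real.log (q i)) ≤ ∫ x in R ⁻¹' {i}, B x ∂ν := by
        rw [← smul_eq_mul, ← setIntegral_const]
        refine setIntegral_mono_on integrableOn_const hB.integrableOn (hR i) fun x hx => ?_
        have := hqB x
        rw [show R x = i from hx, ← Real.le_log_iff_exp_le hqpos] at this
        linarith
      have hlog := Real.log_le_sub_one_of_pos (div_pos hqpos hpos)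
      rw [Real.log_div hqpos.ne' hpos.ne'] at hlog
      have h3 : ν.real (R ⁻¹' {i}) * (Real.log (q i) - Real.log (ν.real (R ⁻¹' {i}))) ≤
          q i - ν.real (R ⁻¹' {i}) := by
        refine (mul_le_mul_of_nonneg_left hlog hpos.le).trans (le_of_eq ?_)
        field_simp
      rw [Real.negMulLog]
      linarith
  calc partEnt ν R ≤ ∑ i, ((∫ x in R ⁻¹' {i}, B x ∂ν) + (q i - ν.real (R ⁻¹' {i}))) :=
        Finset.sum_le_sum fun i _ => key i
    _ = (∫ x, B x ∂ν) + ((∑ i, q i) - 1) := by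
        rw [Finset.sum_add_distrib, Finset.sum_sub_distrib, h2, h1]
    _ ≤ ∫ x, B x ∂ν := by linarith

/-- The conditional weight of the letter `a` of `Fin k` given a letter of `Fin (k + 1)`: the
letter `0` carries no information and `i.succ` determines `a = i`. -/
noncomputable def decodeWeight {k : ℕ} (j : Fin (k + 1)) (a : Fin k) : ℝ :=
  Fin.cases (1 / (k : ℝ)) (fun i => if a = i then 1 else 0) j

lemma decodeWeight_nonneg {k : ℕ} (j : Fin (k + 1)) (a : Fin k) : 0 ≤ decodeWeight j a := by
  induction j using Fin.cases with
  | zero => simp [decodeWeight]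
  | succ i => simp only [decodeWeight, Fin.cases_succ]; split_ifs <;> norm_num

lemma sum_decodeWeight {k : ℕ} (hk : 0 < k) (j : Fin (k + 1)) :
    ∑ a, decodeWeight j a = 1 := by
  have : (k : ℝ) ≠ 0 := by positivity
  induction j using Fin.cases with
  | zero => simp [decodeWeight, this]
  | succ i => simp [decodeWeight]

/-- The weight of a block of letters of `Fin k`, obtained by first drawing an itinerary with
respect to `Q` and then decoding it letter by letter. -/
noncomputable def blockWeight [MeasurableSpace X] (ν : Measure X) (f : X → X) {k : ℕ}
    (Q : X → Fin (k + 1)) (l : ℕ) (ω : ℕ → Fin k) : ℝ :=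
  ∑ w : Fin l → Fin (k + 1), ν.real (itin f Q l ⁻¹' {w}) * ∏ i, decodeWeight (w i) (ω i)

section blockWeight

variable [MeasurableSpace X] {ν : Measure X} {f : X → X} {k : ℕ} {Q : X → Fin (k + 1)}

lemma measurable_itin {A : Type*} [MeasurableSpace A] {R : X → A} (hf : Measurable f)
    (hR : Measurable R) (n : ℕ) : Measurable (itin f R n) :=
  measurable_pi_lambda _ fun _ => hR.comp (hf.iterate _)

lemma blockWeight_nonneg (l : ℕ) (ω : ℕ → Fin k) : 0 ≤ blockWeight ν f Q l ω :=
  Finset.sum_nonneg fun _ _ => mul_nonneg measureReal_nonneg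
    (Finset.prod_nonneg fun _ _ => decodeWeight_nonneg _ _)

lemma blockWeight_congr (l : ℕ) (ω ω' : ℕ → Fin k) (h : ∀ i < l, ω i = ω' i) :
    blockWeight ν f Q l ω = blockWeight ν f Q l ω' := by
  refine Finset.sum_congr rfl fun w _ => ?_
  congr 1
  exact Finset.prod_congr rfl fun i _ => by rw [h i i.2]

lemma sum_measureReal_preimage [IsProbabilityMeasure ν] {ι : Type*} [Fintype ι] {R : X → ι}
    (hR : ∀ i, MeasurableSet (R ⁻¹' {i})) : ∑ i, ν.real (R ⁻¹' {i}) = 1 := by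
  have hdisj : Pairwise (Function.onFun Disjoint fun i => R ⁻¹' {i}) := by
    intro i j hij
    exact Disjoint.preimage _ (by simpa using hij)
  have hun : (⋃ i, R ⁻¹' {i}) = univ := by ext; simp
  have := measureReal_iUnion_fintype (μ := ν) hdisj hR
  rw [hun] at this
  simpa using this.symm

lemma sum_blockWeight_le [IsProbabilityMeasure ν] [Nonempty (Fin k)] (hf : Measurable f)
    (hQ : Measurable Q) (l : ℕ) :
    ∑ u : Fin l → Fin k, blockWeight ν f Q l (extendWord u) ≤ 1 := by
  have hk : 0 < k := Fin.pos_iff_nonempty.2 inferInstance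
  simp only [blockWeight]
  rw [Finset.sum_comm, ← sum_measureReal_preimage (ν := ν)
    fun w => (measurable_itin hf hQ l) (measurableSet_singleton w)]
  refine Finset.sum_le_sum fun w _ => ?_
  rw [← Finset.mul_sum]
  have : ∑ u : Fin l → Fin k, ∏ i, decodeWeight (w i) (extendWord u i) = 1 := by
    have h := Finset.prod_univ_sum (fun _ : Fin l => (Finset.univ : Finset (Fin k)))
      (fun i a => decodeWeight (w i) a)
    rw [Fintype.piFinset_univ] at h
    simp only [sum_decodeWeight hk, Finset.prod_const_one] at h
    rw [h]
    refine Finset.sum_congr rfl fun u _ => Finset.prod_congr rfl fun i _ => ?_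
    rw [extendWord_of_lt _ i.2]
  rw [this, mul_one]

lemma exp_le_blockWeight {P : X → Fin k} (hPQ : ∀ x j, Q x = Fin.succ j → P x = j)
    (l : ℕ) (x : X) :
    ν.real (itin f Q l ⁻¹' {itin f Q l x}) * Real.exp (-(Real.log (2 * k) *
      ∑ i ∈ Finset.range l, (Q ⁻¹' {0}).indicator 1 (f^[i] x))) ≤
      blockWeight ν f Q l (fun i => P (f^[i] x)) := by
  have hk : 0 < k := by have := (P x).2; omega
  have hk' : (1 : ℝ) ≤ k := by exact_mod_cast hk
  have hletter : ∀ z : X, Real.exp (-(Real.log (2 * k) * (Q ⁻¹' {0}).indicator 1 z)) ≤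
      decodeWeight (Q z) (P z) := by
    intro z
    rcases Fin.eq_zero_or_eq_succ (Q z) with h0 | ⟨j, hj⟩
    · rw [indicator_of_mem (by exact h0), h0]
      simp only [Pi.one_apply, mul_one, decodeWeight, Fin.cases_zero]
      rw [Real.exp_neg, Real.exp_log (by positivity), ← one_div]
      exact one_div_le_one_div_of_le (by positivity) (by linarith)
    · have hne : z ∉ Q ⁻¹' {0} := by
        simp [hj, Fin.succ_ne_zero]
      rw [indicator_of_notMem hne, hj, hPQ z j hj]
      simp [decodeWeight]
  calc _ ≤ ν.real (itin f Q l ⁻¹' {itin f Q l x}) *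
        ∏ i : Fin l, decodeWeight (itin f Q l x i) (P (f^[(i : ℕ)] x)) := by
        refine mul_le_mul_of_nonneg_left ?_ measureReal_nonneg
        rw [Finset.mul_sum, ← Finset.sum_neg_distrib, Real.exp_sum,
          ← Fin.prod_univ_eq_prod_range (fun i => Real.exp (-(Real.log (2 * k) *
            (Q ⁻¹' {0}).indicator 1 (f^[i] x)))) l]
        exact Finset.prod_le_prod (fun _ _ => (Real.exp_pos _).le) fun i _ => hletter _
    _ ≤ _ := Finset.single_le_sum (f := fun w : Fin l → Fin (k + 1) =>
        ν.real (itin f Q l ⁻¹' {w}) * ∏ i, decodeWeight (w i) (P (f^[(i : ℕ)] x)))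
        (fun w _ => mul_nonneg measureReal_nonneg
          (Finset.prod_nonneg fun _ _ => decodeWeight_nonneg _ _)) (Finset.mem_univ _)

/-- Lower bound for the universal code along an orbit: outside `bad`, the orbit can be parsed
into blocks of length at most `L` and measure at least `exp (-H l)`. -/
lemma exp_le_codeWeight {P : X → Fin k} (hPQ : ∀ x j, Q x = Fin.succ j → P x = j)
    {H : ℝ} (hH : 0 ≤ H) {L : ℕ} {bad : Set X}
    (hgood : ∀ x ∉ bad, ∃ l, l + 1 ≤ L ∧ Real.exp (-(H * (l + 1 : ℕ))) ≤
      ν.real (itin f Q (l + 1) ⁻¹' {itin f Q (l + 1) x})) (N : ℕ) : ∀ x : X,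
    Real.exp (-((H + 2 * Real.log 2) * N + Real.log (2 * k) *
      (∑ i ∈ Finset.range N,
        ((Q ⁻¹' {0}).indicator 1 (f^[i] x) + bad.indicator 1 (f^[i] x))) +
      Real.log (2 * k) * (min N L : ℕ))) ≤
      codeWeight (blockWeight ν f Q) N (fun i => P (f^[i] x)) := by
  induction N using Nat.strong_induction_on with
  | _ N ih =>
    intro x
    have hk : 0 < k := by have := (P x).2; omega
    have hk' : (1 : ℝ) ≤ k := by exact_mod_cast hk
    have hD : 0 ≤ Real.log (2 * k) := Real.log_nonneg (by linarith)
    have hlog2 : 0 ≤ Real.log 2 := Real.log_nonneg (by norm_num)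
    have hind : ∀ (s : Set X) (z : X), 0 ≤ s.indicator (1 : X → ℝ) z := fun s z =>
      indicator_nonneg (fun _ _ => zero_le_one) z
    cases N with
    | zero => simp [codeWeight_zero]
    | succ N =>
      by_cases hcase : ∃ l, l ≤ N ∧ l + 1 ≤ L ∧ Real.exp (-(H * (l + 1 : ℕ))) ≤
          ν.real (itin f Q (l + 1) ⁻¹' {itin f Q (l + 1) x})
      · obtain ⟨j, hjN, hjL, hj⟩ := hcase
        obtain ⟨m, rfl⟩ := Nat.exists_eq_add_of_le' hjN
        have h1 := codeWeight_block_le (p := blockWeight ν f Q) blockWeight_nonneg j m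
          (fun i => P (f^[i] x))
        rw [← add_assoc] at h1
        refine le_trans ?_ h1
        have h2 := exp_le_blockWeight (ν := ν) (f := f) hPQ (j + 1) x
        have h3 := ih m (by omega) (f^[j + 1] x)
        simp only [← Function.iterate_add_apply] at h3
        have h4 : (1 / 2 : ℝ) ^ (j + 2) ≥ Real.exp (-(2 * Real.log 2 * (j + 1 : ℕ))) := by
          have : Real.exp (-(Real.log 2 * (j + 2 : ℕ))) = (1 / 2 : ℝ) ^ (j + 2) := by
            rw [← neg_mul, mul_comm, Real.exp_nat_mul, Real.exp_neg,
              Real.exp_log (by norm_num), one_div]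
          rw [← this]
          refine Real.exp_le_exp.2 (neg_le_neg ?_)
          push_cast
          nlinarith [mul_nonneg hlog2 (Nat.cast_nonneg (α := ℝ) j)]
        have h5 := (mul_le_mul_of_nonneg_right hj (Real.exp_pos (-(Real.log (2 * k) *
          ∑ i ∈ Finset.range (j + 1), (Q ⁻¹' {0}).indicator 1 (f^[i] x)))).le).trans h2
        refine le_trans ?_ (mul_le_mul h4 (mul_le_mul h5 h3 (Real.exp_pos _).le
          (blockWeight_nonneg _ _)) (by positivity) (by positivity))
        rw [← Real.exp_add, ← Real.exp_add, ← Real.exp_add]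
        refine Real.exp_le_exp.2 ?_
        have hmin : ((min m L : ℕ) : ℝ) ≤ (min (m + j + 1) L : ℕ) := by
          exact_mod_cast min_le_min (by omega) le_rfl
        have hs : ∑ i ∈ Finset.range (m + j + 1),
            ((Q ⁻¹' {0}).indicator (1 : X → ℝ) (f^[i] x) + bad.indicator 1 (f^[i] x)) =
            ∑ i ∈ Finset.range (j + 1),
              ((Q ⁻¹' {0}).indicator 1 (f^[i] x) + bad.indicator 1 (f^[i] x)) +
            ∑ i ∈ Finset.range m, ((Q ⁻¹' {0}).indicator 1 (f^[i + (j + 1)] x) +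
              bad.indicator 1 (f^[i + (j + 1)] x)) := by
          rw [show m + j + 1 = (j + 1) + m by omega, Finset.sum_range_add]
          simp only [add_comm (j + 1)]
        rw [hs, Finset.sum_add_distrib (s := Finset.range (j + 1))]
        have hb : 0 ≤ ∑ i ∈ Finset.range (j + 1), bad.indicator (1 : X → ℝ) (f^[i] x) :=
          Finset.sum_nonneg fun _ _ => hind _ _
        have := mul_le_mul_of_nonneg_left hmin hD
        have := mul_nonneg hD hb
        push_cast at *
        linarith
      · have h1 := codeWeight_letter_le (p := blockWeight ν f Q) blockWeight_nonneg N
          (fun i => P (f^[i] x))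
        refine le_trans ?_ h1
        have h3 := ih N (by omega) (f x)
        simp only [← Function.iterate_succ_apply] at h3
        have h4 : (1 / (2 * (Fintype.card (Fin k) : ℝ))) = Real.exp (-Real.log (2 * k)) := by
          rw [Fintype.card_fin, Real.exp_neg, Real.exp_log (by positivity), one_div]
        rw [h4]
        refine le_trans ?_ (mul_le_mul_of_nonneg_left h3 (Real.exp_pos _).le)
        rw [← Real.exp_add]
        refine Real.exp_le_exp.2 ?_
        have hkey : (1 : ℝ) + (min N L : ℕ) ≤
            bad.indicator (1 : X → ℝ) x + (min (N + 1) L : ℕ) := by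
          by_cases hx : x ∈ bad
          · rw [indicator_of_mem hx]
            simp
          · rw [indicator_of_notMem hx]
            obtain ⟨l, hl, hl'⟩ := hgood x hx
            have hNl : N < l := by
              by_contra hcon
              exact hcase ⟨l, by omega, hl, hl'⟩
            have : 1 + min N L = min (N + 1) L := by omega
            rw [zero_add]
            exact_mod_cast this.le
        rw [Finset.sum_range_succ']
        simp only [Function.iterate_zero, id_eq]
        have := mul_le_mul_of_nonneg_left hkey hD
        have := mul_nonneg hD (hind (Q ⁻¹' {0}) x)
        push_cast at *
        linarith

end blockWeight

section entropyBound

variable [MeasurableSpace X] {ν : Measure X} {f : X → X} {k : ℕ}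
  {Q : X → Fin (k + 1)}

lemma integrable_indicator_iterate [IsFiniteMeasure ν] (hf : MeasurePreserving f ν ν) {s : Set X}
    (hs : MeasurableSet s) (i : ℕ) :
    Integrable (fun x => s.indicator (1 : X → ℝ) (f^[i] x)) ν :=
  (hf.iterate i).integrable_comp_of_integrable ((integrable_const (1 : ℝ)).indicator hs)

lemma integral_indicator_iterate (hf : MeasurePreserving f ν ν) {s : Set X}
    (hs : MeasurableSet s) (i : ℕ) :
    ∫ x, s.indicator (1 : X → ℝ) (f^[i] x) ∂ν = ν.real s := by
  have : (fun x => s.indicator (1 : X → ℝ) (f^[i] x)) = (f^[i] ⁻¹' s).indicator 1 := by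
    ext x; simp only [indicator]; rfl
  rw [this, integral_indicator_one ((hf.iterate i).measurable hs), measureReal_def,
    (hf.iterate i).measure_preimage hs.nullMeasurableSet, ← measureReal_def]

lemma partEnt_itin_le [IsProbabilityMeasure ν] (hf : MeasurePreserving f ν ν)
    {P : X → Fin k} (hP : Measurable P)
    (hQ : Measurable Q) (hPQ : ∀ x j, Q x = Fin.succ j → P x = j)
    {H : ℝ} (hH : 0 ≤ H) {L : ℕ} {bad : Set X} (hbad : MeasurableSet bad)
    (hgood : ∀ x ∉ bad, ∃ l, l + 1 ≤ L ∧ Real.exp (-(H * (l + 1 : ℕ))) ≤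
      ν.real (itin f Q (l + 1) ⁻¹' {itin f Q (l + 1) x})) (N : ℕ) :
    partEnt ν (itin f P N) ≤ (H + 2 * Real.log 2) * N +
      Real.log (2 * k) * (N * (ν.real (Q ⁻¹' {0}) + ν.real bad)) + Real.log (2 * k) * L := by
  obtain ⟨x0⟩ : Nonempty X := nonempty_of_isProbabilityMeasure ν
  have : Nonempty (Fin k) := ⟨P x0⟩
  have hk : 0 < k := Fin.pos_iff_nonempty.2 inferInstance
  have hk' : (1 : ℝ) ≤ k := by exact_mod_cast hk
  have hD : 0 ≤ Real.log (2 * k) := Real.log_nonneg (by linarith)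
  have hQ0 : MeasurableSet (Q ⁻¹' {0}) := hQ (measurableSet_singleton 0)
  have hint : ∀ i, Integrable (fun x => (Q ⁻¹' {0}).indicator (1 : X → ℝ) (f^[i] x) +
      bad.indicator 1 (f^[i] x)) ν := fun i =>
    (integrable_indicator_iterate hf hQ0 i).add (integrable_indicator_iterate hf hbad i)
  have hsum : Integrable (fun x => Real.log (2 * k) * ∑ i ∈ Finset.range N,
      ((Q ⁻¹' {0}).indicator (1 : X → ℝ) (f^[i] x) + bad.indicator 1 (f^[i] x))) ν :=
    (integrable_finsetSum _ fun i _ => hint i).const_mul _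
  have h := partEnt_le_integral ν (itin f P N)
    (fun w => measurable_itin hf.measurable hP N (measurableSet_singleton w))
    (fun w => codeWeight (blockWeight ν f Q) N (extendWord w))
    (codeWeight_sum_le blockWeight_nonneg blockWeight_congr
      (sum_blockWeight_le hf.measurable hQ) N)
    (fun _ => codeWeight_nonneg blockWeight_nonneg _ _)
    (fun x => (H + 2 * Real.log 2) * N + Real.log (2 * k) *
      (∑ i ∈ Finset.range N,
        ((Q ⁻¹' {0}).indicator 1 (f^[i] x) + bad.indicator 1 (f^[i] x))) +
      Real.log (2 * k) * (min N L : ℕ))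
    (((integrable_const _).add hsum).add (integrable_const _))
    (fun x => (exp_le_codeWeight hPQ hH hgood N x).trans_eq
      (codeWeight_congr blockWeight_congr N _ _ fun i hi => by
        rw [extendWord_of_lt _ hi]; rfl))
  refine h.trans ?_
  rw [integral_add (by exact (integrable_const _).add hsum) (integrable_const _),
    integral_add (integrable_const _) hsum, integral_const, integral_const, integral_const_mul,
    integral_finsetSum _ fun i _ => hint i]
  simp only [integral_add (integrable_indicator_iterate hf hQ0 _)
    (integrable_indicator_iterate hf hbad _), integral_indicator_iterate hf hQ0,
    integral_indicator_iterate hf hbad]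
  simp only [probReal_univ, one_smul, Finset.sum_const, Finset.card_range,
    nsmul_eq_mul]
  have : ((min N L : ℕ) : ℝ) ≤ L := by exact_mod_cast min_le_right _ _
  have := mul_le_mul_of_nonneg_left this hD
  linarith

lemma measurable_measureReal_cylinder {A : Type*} [Finite A] [MeasurableSpace A]
    [MeasurableSingletonClass A] {R : X → A} (hf : Measurable f) (hR : Measurable R) (n : ℕ) :
    Measurable fun x => ν.real (itin f R n ⁻¹' {itin f R n x}) :=
  (measurable_of_countable fun w => ν.real (itin f R n ⁻¹' {w})).comp
    (measurable_itin hf hR n)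

lemma measureReal_cylinder_succ_le [IsFiniteMeasure ν] {A : Type*} [Finite A] [MeasurableSpace A]
    [MeasurableSingletonClass A] {R : X → A} (hf : MeasurePreserving f ν ν)
    (hR : Measurable R) (n : ℕ) (x : X) :
    ν.real (itin f R (n + 1) ⁻¹' {itin f R (n + 1) x}) ≤
      ν.real (itin f R n ⁻¹' {itin f R n (f x)}) := by
  have hm := measurable_itin hf.measurable hR n (measurableSet_singleton (itin f R n (f x)))
  rw [measureReal_def, measureReal_def, ← hf.measure_preimage hm.nullMeasurableSet]
  refine ENNReal.toReal_mono (measure_ne_top _ _) (measure_mono fun z hz => ?_)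
  funext i
  have := congrFun (show itin f R (n + 1) z = itin f R (n + 1) x from hz) i.succ
  simpa [itin] using this

/-- If the entropy of `P` is large and `Q` approximates `P`, then for almost every point the
`Q`-cylinders eventually decay at a large exponential rate. -/
theorem ae_eventually_cylinder_le [IsProbabilityMeasure ν] (hf : Ergodic f ν)
    {P : X → Fin k} (hP : Measurable P)
    (hQ : Measurable Q) (hPQ : ∀ x j, Q x = Fin.succ j → P x = j)
    (hQ0 : Real.log (2 * k) * ν.real (Q ⁻¹' {0}) ≤ 1) {H : ℝ} (hH : 0 ≤ H)
    (hlim : ENNReal.ofReal (H + 1 + 2 * Real.log 2 + 2) <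
      limsup (fun n : ℕ => ENNReal.ofReal (partEnt ν (itin f P n) / n)) atTop) :
    ∀ᵐ x ∂ν, ∀ᶠ n : ℕ in atTop,
      ν.real (itin f Q n ⁻¹' {itin f Q n x}) ≤ Real.exp (-(H * n)) := by
  have hmp := hf.toMeasurePreserving
  set p : ℕ → X → ℝ := fun n x => ν.real (itin f Q n ⁻¹' {itin f Q n x}) with hp
  have hpm : ∀ n, Measurable (p n) := fun n =>
    measurable_measureReal_cylinder hmp.measurable hQ n
  set U : Set X := {x | ∃ c : ℕ, ∃ᶠ n : ℕ in atTop, Real.exp (-(H * n)) < c * p n x} with hU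
  have hUm : MeasurableSet U := by
    have : U = ⋃ c : ℕ, limsup (fun n : ℕ => {x | Real.exp (-(H * n)) < c * p n x}) atTop := by
      ext x
      simp only [hU, mem_ofPred_eq, mem_iUnion, mem_limsup_iff_frequently_mem]
    rw [this]
    exact MeasurableSet.iUnion fun c => MeasurableSet.measurableSet_limsup fun n =>
      measurableSet_lt measurable_const ((hpm n).const_mul _)
  have hUsub : U ⊆ f ⁻¹' U := by
    rintro x ⟨c, hc⟩
    obtain ⟨c', hc'⟩ := exists_nat_ge (Real.exp H * c)
    refine ⟨c', ?_⟩
    rw [frequently_atTop] at hc ⊢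
    intro a
    obtain ⟨b, hb, hlt⟩ := hc (a + 1)
    obtain ⟨n, rfl⟩ : ∃ n, b = n + 1 := ⟨b - 1, by omega⟩
    refine ⟨n, by omega, ?_⟩
    have h1 := measureReal_cylinder_succ_le hmp hQ n x
    have h0 : 0 ≤ p (n + 1) x := measureReal_nonneg
    have h0' : 0 ≤ p n (f x) := measureReal_nonneg
    calc Real.exp (-(H * n)) = Real.exp H * Real.exp (-(H * (n + 1 : ℕ))) := by
          rw [← Real.exp_add]; congr 1; push_cast; ring
      _ < Real.exp H * (c * p (n + 1) x) := mul_lt_mul_of_pos_left hlt (Real.exp_pos _)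
      _ = (Real.exp H * c) * p (n + 1) x := by ring
      _ ≤ (Real.exp H * c) * p n (f x) := mul_le_mul_of_nonneg_left h1 (by positivity)
      _ ≤ c' * p n (f x) := mul_le_mul_of_nonneg_right hc' h0'
  rcases hf.ae_empty_or_univ_of_ae_le_preimage hUm.nullMeasurableSet
    (Eventually.of_forall hUsub) with hempty | huniv
  · have : ∀ᵐ x ∂ν, x ∉ U := measure_eq_zero_iff_ae_notMem.1 (ae_eq_empty.1 hempty)
    filter_upwards [this] with x hx
    have hx' : ¬ ∃ᶠ n : ℕ in atTop, Real.exp (-(H * n)) < (1 : ℕ) * p n x :=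
      fun hcon => hx ⟨1, hcon⟩
    rw [not_frequently] at hx'
    filter_upwards [hx'] with n hn
    simpa using hn
  · exfalso
    set bad : ℕ → Set X := fun L => {x | ∀ l, l + 1 ≤ L →
      p (l + 1) x < Real.exp (-((H + 1) * (l + 1 : ℕ)))} with hbad
    have hbadm : ∀ L, MeasurableSet (bad L) := by
      intro L
      have : bad L = ⋂ l : ℕ, ⋂ _ : l + 1 ≤ L,
          {x | p (l + 1) x < Real.exp (-((H + 1) * (l + 1 : ℕ)))} := by
        ext x; simp [hbad]
      rw [this]
      exact MeasurableSet.iInter fun l => MeasurableSet.iInter fun _ =>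
        measurableSet_lt (hpm _) measurable_const
    have hanti : Antitone bad := fun L L' hL x hx l hl => hx l (hl.trans hL)
    have hnull : ν (⋂ L, bad L) = 0 := by
      rw [← nonpos_iff_eq_zero]
      have hUc : ν Uᶜ = 0 := ae_eq_univ.1 huniv
      rw [← hUc]
      refine measure_mono fun x hx hxU => ?_
      obtain ⟨c, hc⟩ := hxU
      obtain ⟨c', hc'⟩ := exists_nat_ge (Real.log c)
      rw [frequently_atTop] at hc
      obtain ⟨b, hb, hlt⟩ := hc (c' + 1)
      obtain ⟨n, rfl⟩ : ∃ n, b = n + 1 := ⟨b - 1, by omega⟩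
      have h1 := mem_iInter.1 hx (n + 1) n le_rfl
      have hc0 : (0 : ℝ) < c := by
        rcases Nat.eq_zero_or_pos c with h | h
        · rw [h, Nat.cast_zero, zero_mul] at hlt
          exact absurd hlt (Real.exp_pos _).not_gt
        · exact_mod_cast h
      have h2 : (c : ℝ) ≤ Real.exp (n + 1 : ℕ) := by
        rw [← Real.log_le_iff_le_exp hc0]
        refine hc'.trans ?_
        exact_mod_cast by omega
      have h3 : (c : ℝ) * p (n + 1) x ≤
          Real.exp (n + 1 : ℕ) * Real.exp (-((H + 1) * (n + 1 : ℕ))) :=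
        mul_le_mul h2 h1.le measureReal_nonneg (Real.exp_pos _).le
      rw [← Real.exp_add] at h3
      have : ((n + 1 : ℕ) : ℝ) + -((H + 1) * (n + 1 : ℕ)) = -(H * (n + 1 : ℕ)) := by ring
      rw [this] at h3
      exact absurd (hlt.trans_le h3) (lt_irrefl _)
    have htend := tendsto_measure_iInter_atTop (μ := ν)
      (fun L => (hbadm L).nullMeasurableSet) hanti ⟨0, measure_ne_top _ _⟩
    rw [hnull] at htend
    have htend' : Tendsto (fun L => Real.log (2 * k) * ν.real (bad L)) atTop (𝓝 0) := by
      have := ((ENNReal.tendsto_toReal ENNReal.zero_ne_top).comp htend).const_mul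
        (Real.log (2 * k))
      simpa [Measure.real] using this
    obtain ⟨L, hL⟩ := (htend'.eventually (gt_mem_nhds zero_lt_one)).exists
    have hbound := fun N => partEnt_itin_le (L := L) hmp hP hQ hPQ (by linarith : 0 ≤ H + 1) (hbadm L)
      (fun x hx => by
        by_contra hcon
        push Not at hcon
        exact hx fun l hl => hcon l hl) N
    have hev : ∀ N : ℕ, ENNReal.ofReal (partEnt ν (itin f P N) / N) ≤
        ENNReal.ofReal (H + 1 + 2 * Real.log 2 + (Real.log (2 * k) * ν.real (Q ⁻¹' {0}) +
          Real.log (2 * k) * ν.real (bad L)) + Real.log (2 * k) * L * (N : ℝ)⁻¹) := by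
      intro N
      rcases Nat.eq_zero_or_pos N with rfl | hN
      · simp
      · have hN' : (0 : ℝ) < N := by exact_mod_cast hN
        refine ENNReal.ofReal_le_ofReal ?_
        rw [div_le_iff₀ hN']
        refine (hbound N).trans (le_of_eq ?_)
        field_simp
    have hlim2 : Tendsto (fun N : ℕ => ENNReal.ofReal (H + 1 + 2 * Real.log 2 +
        (Real.log (2 * k) * ν.real (Q ⁻¹' {0}) + Real.log (2 * k) * ν.real (bad L)) +
          Real.log (2 * k) * L * (N : ℝ)⁻¹)) atTop
        (𝓝 (ENNReal.ofReal (H + 1 + 2 * Real.log 2 + (Real.log (2 * k) * ν.real (Q ⁻¹' {0}) +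
          Real.log (2 * k) * ν.real (bad L))))) := by
      refine ENNReal.tendsto_ofReal ?_
      have := (tendsto_inv_atTop_nhds_zero_nat (𝕜 := ℝ)).const_mul (Real.log (2 * k) * L)
      have := this.const_add (H + 1 + 2 * Real.log 2 +
        (Real.log (2 * k) * ν.real (Q ⁻¹' {0}) + Real.log (2 * k) * ν.real (bad L)))
      simpa using this
    have h1 := limsup_le_limsup (f := atTop) (Eventually.of_forall hev)
    rw [hlim2.limsup_eq] at h1
    refine absurd (hlim.trans_le h1) (not_lt.2 (ENNReal.ofReal_le_ofReal ?_))
    linarith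

end entropyBound

section flow

variable [MetricSpace X] {φ : ℝ → X → X}

lemma IsFlow.int_mul_eq_self (hφ : IsFlow φ) {t : ℝ} {x : X} (h : φ t x = x) (m : ℤ) :
    φ (m * t) x = x := by
  have hneg : φ (-t) x = x := by
    conv_lhs => rw [← h]
    rw [← hφ.map_add, neg_add_cancel, hφ.map_zero]
  induction m with
  | zero => simp [hφ.map_zero]
  | succ i ih => rw [Int.cast_add, add_mul, hφ.map_add, Int.cast_one, one_mul, h, ih]
  | pred i ih => rw [Int.cast_sub, sub_mul, sub_eq_add_neg, hφ.map_add, Int.cast_one, one_mul,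
      hneg, ih]

lemma IsFlow.iterate_eq (hφ : IsFlow φ) (T : ℝ) (j : ℕ) (x : X) :
    (φ T)^[j] x = φ (j * T) x := by
  induction j with
  | zero => simp [hφ.map_zero]
  | succ j ih =>
    rw [Function.iterate_succ_apply', ih, ← hφ.map_add]
    congr 1
    push_cast
    ring

/-- The set of pairs `(x, y)` with `y` in the reparametrization ball of `x` is open. -/
lemma IsFlow.isOpen_reparBall_prod (hφ : IsFlow φ) (t ε : ℝ) :
    IsOpen {q : X × X | q.2 ∈ reparBall φ q.1 t ε} := by
  rw [isOpen_iff_mem_nhds]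
  rintro ⟨x, y⟩ ⟨α, hα, hs⟩
  have hcont : Continuous fun q : ℝ × ℝ × X × X =>
      dist (φ q.1 q.2.2.1) (φ q.2.1 q.2.2.2) :=
    (hφ.cont.comp (by fun_prop : Continuous fun q : ℝ × ℝ × X × X => (q.1, q.2.2.1))).dist
      (hφ.cont.comp (by fun_prop : Continuous fun q : ℝ × ℝ × X × X => (q.2.1, q.2.2.2)))
  have hcompact : IsCompact ((fun s => (α s, s)) '' Icc 0 t) :=
    isCompact_Icc.image_of_continuousOn (hα.1.prodMk continuousOn_id)
  have hev : ∀ᶠ q : X × X in 𝓝 (x, y), ∀ c ∈ (fun s => (α s, s)) '' Icc 0 t,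
      dist (φ c.1 q.1) (φ c.2 q.2) < ε := by
    refine hcompact.eventually_forall_of_forall_eventually fun c hc => ?_
    obtain ⟨s, hs', rfl⟩ := hc
    have hcont' : Continuous fun q : (X × X) × (ℝ × ℝ) =>
        dist (φ q.2.1 q.1.1) (φ q.2.2 q.1.2) :=
      hcont.comp (by fun_prop : Continuous fun q : (X × X) × (ℝ × ℝ) =>
        (q.2.1, q.2.2, q.1.1, q.1.2))
    exact hcont'.continuousAt.eventually_lt continuousAt_const (hs s hs')
  filter_upwards [hev] with q hq
  exact ⟨α, hα, fun s hs' => hq _ ⟨s, hs', rfl⟩⟩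

variable [CompactSpace X]

lemma IsFlow.exists_dist_lt (hφ : IsFlow φ) (U : ℝ) {r : ℝ} (hr : 0 < r) :
    ∃ δ > 0, ∀ s s' : ℝ, |s| ≤ U → |s'| ≤ U → ∀ x x' : X, |s - s'| < δ → dist x x' < δ →
      dist (φ s x) (φ s' x') < r := by
  have hK : IsCompact (Icc (-U) U ×ˢ (univ : Set X)) := isCompact_Icc.prod isCompact_univ
  have := hK.uniformContinuousOn_of_continuous hφ.cont.continuousOn
  rw [Metric.uniformContinuousOn_iff] at this
  obtain ⟨δ, hδ, h⟩ := this r hr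
  refine ⟨δ, hδ, fun s s' hs hs' x x' h1 h2 => ?_⟩
  refine h (s, x) ⟨abs_le.1 hs, trivial⟩ (s', x') ⟨abs_le.1 hs', trivial⟩ ?_
  rw [Prod.dist_eq, Real.dist_eq]
  exact max_lt h1 h2

/-- A flow without fixed points on a compact space has no short periods. -/
lemma IsFlow.exists_period_gap (hφ : IsFlow φ) (hfp : FixedPointFree φ) :
    ∃ η > 0, ∀ t : ℝ, 0 < |t| → |t| ≤ η → ∀ x : X, φ t x ≠ x := by
  by_contra! hcon
  have h := fun n : ℕ => hcon (1 / ((n : ℝ) + 1)) (by positivity)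
  choose t ht0 ht x hx using h
  obtain ⟨a, -, ψ, hψ, hlim⟩ := isCompact_univ.tendsto_subseq (fun n => mem_univ (x n))
  obtain ⟨s, hs⟩ := hfp a
  apply hs
  have ht' : Tendsto t atTop (𝓝 0) :=
    squeeze_zero_norm (fun n => ht n) tendsto_one_div_add_atTop_nhds_zero_nat
  have hfl : Tendsto (fun n => (⌊s / t n⌋ : ℝ) * t n) atTop (𝓝 s) := by
    rw [tendsto_iff_norm_sub_tendsto_zero]
    refine squeeze_zero (fun _ => norm_nonneg _) (fun n => ?_) (tendsto_norm_zero.comp ht')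
    have h0 : t n ≠ 0 := abs_pos.1 (ht0 n)
    have : (⌊s / t n⌋ : ℝ) * t n - s = -(Int.fract (s / t n) * t n) := by
      rw [Int.fract]; field_simp; ring
    rw [this, norm_neg, norm_mul, Function.comp_apply]
    refine mul_le_of_le_one_left (norm_nonneg _) ?_
    rw [Real.norm_eq_abs, abs_of_nonneg (Int.fract_nonneg _)]
    exact (Int.fract_lt_one _).le
  have h1 : Tendsto (fun n => φ ((⌊s / t (ψ n)⌋ : ℝ) * t (ψ n)) (x (ψ n))) atTop
      (𝓝 (φ s a)) :=
    (hφ.cont.tendsto (s, a)).comp ((hfl.comp hψ.tendsto_atTop).prodMk_nhds hlim)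
  refine tendsto_nhds_unique h1 ?_
  simp only [hφ.int_mul_eq_self (hx _)]
  exact hlim

lemma IsFlow.exists_le_dist (hφ : IsFlow φ) {a : ℝ} (ha : ∀ x, φ a x ≠ x) :
    ∃ κ > 0, ∀ x, κ ≤ dist (φ a x) x := by
  have hc : Continuous fun x => dist (φ a x) x :=
    (hφ.cont.comp (Continuous.prodMk_right a)).dist continuous_id
  obtain ⟨κ, hκ, h⟩ := isCompact_univ.exists_forall_le' hc.continuousOn
    (a := 0) fun x _ => dist_pos.2 (ha x)
  exact ⟨κ, hκ, fun x => h x trivial⟩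

/-- Orbits that shadow each other up to a reparametrization stay synchronized. -/
lemma IsFlow.exists_drift (hφ : IsFlow φ) {g : ℝ} (hg : 0 < g)
    (hgap : ∀ t : ℝ, 0 < |t| → |t| ≤ g → ∀ x : X, φ t x ≠ x) (U : ℝ) :
    ∃ ε > 0, ∀ (x y : X) (α : ℝ → ℝ) (u : ℝ), 0 ≤ u → u ≤ U → ContinuousOn α (Icc 0 u) →
      α 0 = 0 → (∀ s ∈ Icc 0 u, dist (φ (α s) x) (φ s y) < ε) → |α u - u| ≤ g := by
  obtain ⟨κ₁, hκ₁, h₁⟩ := hφ.exists_le_dist (a := g)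
    (hgap g (abs_pos.2 hg.ne') (abs_of_pos hg).le)
  obtain ⟨κ₂, hκ₂, h₂⟩ := hφ.exists_le_dist (a := -g)
    (hgap (-g) (abs_pos.2 (neg_ne_zero.2 hg.ne')) (by rw [abs_neg, abs_of_pos hg]))
  set κ := min κ₁ κ₂ with hκ
  have hκ0 : 0 < κ := lt_min hκ₁ hκ₂
  obtain ⟨δ, hδ, hunif⟩ := hφ.exists_dist_lt U (half_pos hκ0)
  refine ⟨min δ (κ / 2), lt_min hδ (half_pos hκ0), fun x y α u hu0 huU hα hα0 hsh => ?_⟩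
  by_contra! hlt
  have hcont : ContinuousOn (fun s => |α s - s|) (Icc 0 u) := (hα.sub continuousOn_id).abs
  obtain ⟨v, hv, hvg⟩ := intermediate_value_Icc hu0 hcont
    (show g ∈ Icc |α 0 - 0| |α u - u| by rw [hα0]; simpa using ⟨hg.le, hlt.le⟩)
  simp only at hvg
  have hxy : dist x y < κ / 2 := by
    have := hsh 0 ⟨le_rfl, hu0⟩
    rw [hα0, hφ.map_zero, hφ.map_zero] at this
    exact this.trans_le (min_le_right _ _)
  have hvU : |-v| ≤ U := by rw [abs_neg, abs_of_nonneg hv.1]; exact hv.2.trans huU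
  have hback : dist (φ (α v - v) x) y < κ / 2 := by
    have := hunif (-v) (-v) hvU hvU (φ (α v) x) (φ v y) (by simpa using hδ)
      ((hsh v hv).trans_le (min_le_left _ _))
    rwa [← hφ.map_add, ← hφ.map_add, neg_add_cancel, hφ.map_zero, neg_add_eq_sub] at this
  have hclose : dist (φ (α v - v) x) x < κ := by
    have := dist_triangle_right (φ (α v - v) x) x y
    linarith
  rcases (abs_eq hg.le).1 hvg with h | h
  · rw [h] at hclose
    exact absurd ((h₁ x).trans_lt hclose) (not_lt.2 (min_le_left _ _))
  · rw [h] at hclose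
    exact absurd ((h₂ x).trans_lt hclose) (not_lt.2 (min_le_right _ _))

lemma IsFlow.exists_drift_shift (hφ : IsFlow φ) {g : ℝ} (hg : 0 < g)
    (hgap : ∀ t : ℝ, 0 < |t| → |t| ≤ g → ∀ x : X, φ t x ≠ x) (U : ℝ) :
    ∃ ε > 0, ∀ (x y : X) (α : ℝ → ℝ) (t : ℝ), ContinuousOn α (Icc 0 t) →
      (∀ s ∈ Icc 0 t, dist (φ (α s) x) (φ s y) < ε) →
      ∀ s s' : ℝ, 0 ≤ s → s ≤ s' → s' ≤ t → s' - s ≤ U → |α s' - α s - (s' - s)| ≤ g := by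
  obtain ⟨ε, hε, h⟩ := hφ.exists_drift hg hgap U
  refine ⟨ε, hε, fun x y α t hα hsh s s' hs hss' hs't hU => ?_⟩
  have hmem : ∀ v ∈ Icc 0 (s' - s), s + v ∈ Icc 0 t := fun v hv =>
    ⟨by linarith [hv.1], by linarith [hv.2]⟩
  have := h (φ (α s) x) (φ s y) (fun v => α (s + v) - α s) (s' - s) (by linarith) hU
    ((hα.comp (by fun_prop) hmem).sub continuousOn_const) (by simp) fun v hv => by
      rw [← hφ.map_add, ← hφ.map_add, sub_add_cancel, add_comm v s]
      exact hsh _ (hmem v hv)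
  simpa using this

lemma floor_sub_mem_of_abs_sub_le_one {a b : ℝ} (h : |b - a| ≤ 1) :
    0 ≤ ⌊b⌋ - ⌊a⌋ + 1 ∧ ⌊b⌋ - ⌊a⌋ + 1 ≤ 2 := by
  have h' := abs_le.1 h
  have h1 : ⌊a⌋ ≤ ⌊b⌋ + 1 := by
    rw [← Int.floor_add_one]; exact Int.floor_le_floor (by linarith)
  have h2 : ⌊b⌋ ≤ ⌊a⌋ + 1 := by
    rw [← Int.floor_add_one]; exact Int.floor_le_floor (by linarith)
  omega

/-- If the reparametrization balls of `x` and `z` meet, then the orbit of `x` is shadowed by the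
orbit of `z` along times whose deviation from `j * T` performs a walk with steps `0, ±h`. -/
lemma IsFlow.exists_walk (hφ : IsFlow φ) (hfp : FixedPointFree φ) {T r : ℝ} (hT : 0 < T)
    (hr : 0 < r) : ∃ h : ℝ, ∃ ε > 0, ∀ (n m : ℕ) (x z w : X), 2 * m ≤ n →
      w ∈ reparBall φ x (n * T) ε → w ∈ reparBall φ z (n * T) ε →
      ∃ d : ℕ → Fin 3, ∀ j ≤ m, dist (φ (j * T) x)
        (φ (j * T + h * ∑ i ∈ Finset.range j, (((d i : ℕ) : ℝ) - 1)) z) < r := by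
  obtain ⟨η, hη, hgap⟩ := hφ.exists_period_gap hfp
  obtain ⟨δ, hδ, hunif⟩ := hφ.exists_dist_lt 1 (half_pos hr)
  obtain ⟨g, hg, hgη, hgT, hgδ, hg1⟩ : ∃ g > 0, g ≤ η ∧ g ≤ T ∧ 2 * g < δ ∧ 2 * g ≤ 1 := by
    refine ⟨min (min η T) (min (δ / 4) (1 / 2)), by positivity, ?_, ?_, ?_, ?_⟩
    · exact (min_le_left _ _).trans (min_le_left _ _)
    · exact (min_le_left _ _).trans (min_le_right _ _)
    · have := (min_le_right (min η T) (min (δ / 4) (1 / 2))).trans (min_le_left _ _)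
      linarith
    · have := (min_le_right (min η T) (min (δ / 4) (1 / 2))).trans (min_le_right _ _)
      linarith
  obtain ⟨ε₀, hε₀, hdrift⟩ := hφ.exists_drift_shift hg
    (fun t h0 ht => hgap t h0 (ht.trans hgη)) (T + g)
  refine ⟨2 * g, min ε₀ (r / 4), lt_min hε₀ (by positivity), fun n m x z w hmn hx hz => ?_⟩
  obtain ⟨α, ⟨hα, -, hα0⟩, hαs⟩ := hx
  obtain ⟨β, ⟨hβ, -, hβ0⟩, hβs⟩ := hz
  have hαd := hdrift x w α (n * T) hα fun s hs => (hαs s hs).trans_le (min_le_left _ _)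
  have hβd := hdrift z w β (n * T) hβ fun s hs => (hβs s hs).trans_le (min_le_left _ _)
  have hbound : ∀ j : ℕ, j ≤ m → j * (T + g) ≤ n * T := by
    intro j hj
    have h1 : 2 * (j : ℝ) ≤ n := by exact_mod_cast (by omega : 2 * j ≤ n)
    nlinarith [mul_nonneg (Nat.cast_nonneg (α := ℝ) j) (sub_nonneg.2 hgT),
      mul_nonneg (sub_nonneg.2 h1) hT.le]
  have hstep : ∀ (j : ℕ) (s : ℝ), (j ≤ m → 0 ≤ s ∧ s ≤ j * (T + g) ∧ α s = j * T) →
      ∃ s', (j + 1 ≤ m → 0 ≤ s' ∧ s' ≤ (j + 1 : ℕ) * (T + g) ∧ α s' = (j + 1 : ℕ) * T) ∧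
        (j + 1 ≤ m → s ≤ s' ∧ s' - s ≤ T + g) := by
    intro j s hs
    by_cases hj : j + 1 ≤ m
    · obtain ⟨h0, h1, h2⟩ := hs (by omega)
      have hb := hbound (j + 1) hj
      push_cast at hb
      have htop : s + (T + g) ≤ n * T := by linarith
      have hd := (abs_le.1 (hαd s (s + (T + g)) h0 (by linarith) htop (by linarith))).1
      obtain ⟨s', hs', hαs'⟩ := intermediate_value_Icc (by linarith : s ≤ s + (T + g))
        (hα.mono (Icc_subset_Icc h0 htop))
        (show (j + 1 : ℝ) * T ∈ Icc (α s) (α (s + (T + g))) from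
          ⟨by rw [h2]; linarith, by rw [h2] at hd; linarith⟩)
      refine ⟨s', fun _ => ⟨h0.trans hs'.1, ?_, ?_⟩, fun _ => ⟨hs'.1, by linarith [hs'.2]⟩⟩
      · push_cast
        linarith [hs'.2]
      · push_cast
        exact hαs'
    · exact ⟨0, fun h => absurd h hj, fun h => absurd h hj⟩
  choose F hF1 hF2 using hstep
  let sq : ∀ j : ℕ, {s : ℝ // j ≤ m → 0 ≤ s ∧ s ≤ j * (T + g) ∧ α s = j * T} := fun j =>
    Nat.rec ⟨0, fun _ => by simp [hα0]⟩ (fun j q => ⟨F j q.1 q.2, hF1 j q.1 q.2⟩) j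
  let s : ℕ → ℝ := fun j => (sq j).1
  have hs : ∀ j ≤ m, 0 ≤ s j ∧ s j ≤ j * (T + g) ∧ α (s j) = j * T := fun j => (sq j).2
  have hsucc : ∀ j, j + 1 ≤ m → s j ≤ s (j + 1) ∧ s (j + 1) - s j ≤ T + g := fun j =>
    hF2 j (sq j).1 (sq j).2
  have hs0 : s 0 = 0 := rfl
  let b : ℕ → ℤ := fun j => ⌊(β (s j) - j * T) / (2 * g)⌋
  have hb0 : b 0 = 0 := by simp [b, hs0, hβ0]
  have hbstep : ∀ j, j + 1 ≤ m → 0 ≤ b (j + 1) - b j + 1 ∧ b (j + 1) - b j + 1 ≤ 2 := by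
    intro j hj
    apply floor_sub_mem_of_abs_sub_le_one
    obtain ⟨h1, h2⟩ := hsucc j hj
    obtain ⟨h3, -, h4⟩ := hs j (by omega)
    obtain ⟨h5, h6, h7⟩ := hs (j + 1) hj
    have h8 := h6.trans (hbound (j + 1) hj)
    have hA := abs_le.1 (hαd _ _ h3 h1 h8 h2)
    have hB := abs_le.1 (hβd _ _ h3 h1 h8 h2)
    rw [h4, h7] at hA
    push_cast at hA ⊢
    rw [← sub_div, abs_div, abs_of_pos (by positivity : 0 < 2 * g), div_le_one (by positivity),
      abs_le]
    constructor <;> linarith [hA.1, hA.2, hB.1, hB.2]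
  refine ⟨fun j => Fin.ofNat 3 (b (j + 1) - b j + 1).toNat, fun j hj => ?_⟩
  have hsum : ∑ i ∈ Finset.range j,
      (((Fin.ofNat 3 (b (i + 1) - b i + 1).toNat : ℕ) : ℝ) - 1) = b j := by
    have : ∀ i ∈ Finset.range j,
        (((Fin.ofNat 3 (b (i + 1) - b i + 1).toNat : ℕ) : ℝ) - 1) =
          (b (i + 1) : ℝ) - b i := by
      intro i hi
      obtain ⟨h1, h2⟩ := hbstep i (by have := Finset.mem_range.1 hi; omega)
      have h3 : (((Fin.ofNat 3 (b (i + 1) - b i + 1).toNat : Fin 3) : ℕ) : ℤ) =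
          b (i + 1) - b i + 1 := by
        rw [Fin.val_ofNat, Nat.mod_eq_of_lt (by omega)]
        omega
      have h4 : (((Fin.ofNat 3 (b (i + 1) - b i + 1).toNat : Fin 3) : ℕ) : ℝ) =
          b (i + 1) - b i + 1 := by exact_mod_cast h3
      rw [h4]; ring
    rw [Finset.sum_congr rfl this, Finset.sum_range_sub (fun i => (b i : ℝ)), hb0]
    simp
  rw [hsum]
  obtain ⟨h0, h1, h2⟩ := hs j hj
  have hmem : s j ∈ Icc 0 (n * T) := ⟨h0, h1.trans (hbound j hj)⟩
  have hA := (hαs _ hmem).trans_le (min_le_right _ _)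
  have hB := (hβs _ hmem).trans_le (min_le_right _ _)
  rw [h2] at hA
  have hfl1 := Int.floor_le ((β (s j) - j * T) / (2 * g))
  have hfl2 := Int.lt_floor_add_one ((β (s j) - j * T) / (2 * g))
  rw [le_div_iff₀ (by positivity)] at hfl1
  rw [div_lt_iff₀ (by positivity)] at hfl2
  set c := β (s j) - (j * T + 2 * g * b j) with hc
  have hc0 : 0 ≤ c := by simp only [hc, b]; linarith
  have hc1 : c ≤ 2 * g := by simp only [hc, b]; linarith
  have hcabs : |c| = c := abs_of_nonneg hc0
  have hC := hunif c 0 (by rw [hcabs]; linarith) (by simp)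
    (φ (j * T + 2 * g * b j) z) (φ (j * T + 2 * g * b j) z)
    (by rw [sub_zero, hcabs]; linarith) (by simpa using hδ)
  rw [← hφ.map_add, hφ.map_zero, hc, sub_add_cancel] at hC
  have := dist_triangle_right (φ (j * T) x) (φ (β (s j)) z) (φ (s j) w)
  have := dist_triangle (φ (j * T) x) (φ (β (s j)) z) (φ (j * T + 2 * g * b j) z)
  linarith

end flow

section Approximation

/-- A finite measurable partition agrees, off a set of small measure, with a partial coding that
is constant on small balls. -/
theorem exists_partial_coding [MetricSpace X] [CompactSpace X] [MeasurableSpace X] [BorelSpace X]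
    (ν : Measure X) [IsProbabilityMeasure ν] {k : ℕ} {P : X → Fin k} (hP : Measurable P)
    {δ : ℝ} (hδ : 0 < δ) :
    ∃ Q : X → Fin (k + 1), Measurable Q ∧ (∀ x j, Q x = Fin.succ j → P x = j) ∧
      ν.real (Q ⁻¹' {0}) ≤ δ ∧
      ∃ r > 0, ∃ code : X → Fin (k + 1), ∀ u v, dist u v < r → Q u = 0 ∨ Q u = code v := by
  classical
  have hk : 0 < ((k : ℝ) + 1) := by positivity
  have hδk : ENNReal.ofReal (δ / (k + 1)) ≠ 0 := by
    rw [ENNReal.ofReal_ne_zero_iff]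
    positivity
  have key : ∀ i : Fin k, ∃ F, F ⊆ P ⁻¹' {i} ∧ IsClosed F ∧
      ν (P ⁻¹' {i} \ F) < ENNReal.ofReal (δ / (k + 1)) := fun i =>
    (hP (measurableSet_singleton i)).exists_isClosed_sdiff_lt (measure_ne_top ν _) hδk
  choose K hKP hKc hKν using key
  have hKmem : ∀ {i x}, x ∈ K i → P x = i := fun {i x} hx => hKP i hx
  let Q : X → Fin (k + 1) := fun x => if x ∈ K (P x) then (P x).succ else 0
  have hQK : ∀ {x j}, Q x = Fin.succ j → x ∈ K j := by
    intro x j h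
    by_cases hx : x ∈ K (P x)
    · have h' : (P x).succ = Fin.succ j := by simpa [Q, hx] using h
      rw [← Fin.succ_injective _ h']
      exact hx
    · exact absurd (by simpa [Q, hx] using h : (0 : Fin (k + 1)) = Fin.succ j)
        (Fin.succ_ne_zero j).symm
  have hQK' : ∀ {x j}, x ∈ K j → Q x = Fin.succ j := by
    intro x j h
    have := hKmem h
    subst this
    simp [Q, h]
  have hsucc : ∀ j : Fin k, Q ⁻¹' {Fin.succ j} = K j := fun j =>
    Set.ext fun x => ⟨fun h => hQK h, fun h => hQK' h⟩
  have hzero : Q ⁻¹' {0} = ⋃ i, (P ⁻¹' {i} \ K i) := by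
    ext x
    by_cases hx : x ∈ K (P x) <;> simp [Q, hx, Fin.succ_ne_zero]
  refine ⟨Q, ?_, fun x j h => hKmem (hQK h), ?_, ?_⟩
  · refine measurable_to_countable' fun i => ?_
    refine Fin.cases ?_ (fun j => ?_) i
    · rw [hzero]
      exact MeasurableSet.iUnion fun i =>
        (hP (measurableSet_singleton i)).diff (hKc i).measurableSet
    · rw [hsucc]
      exact (hKc j).measurableSet
  · rw [hzero]
    calc ν.real (⋃ i, (P ⁻¹' {i} \ K i)) ≤ ∑ i, ν.real (P ⁻¹' {i} \ K i) :=
          measureReal_iUnion_fintype_le _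
      _ ≤ ∑ _i : Fin k, δ / (k + 1) := Finset.sum_le_sum fun i _ =>
          ENNReal.toReal_le_of_le_ofReal (by positivity) (hKν i).le
      _ = k * (δ / (k + 1)) := by simp
      _ ≤ δ := by
          rw [mul_div_assoc', div_le_iff₀ hk]
          nlinarith
  · let U : Option (Fin k) → Set X := fun o => {x | ∀ j, x ∈ K j → o = some j}
    have hU : ∀ o, IsOpen (U o) := by
      intro o
      have : U o = ⋂ j : {j // o ≠ some j}, (K j)ᶜ := by
        ext x
        simp only [U, Set.mem_ofPred_eq, mem_iInter, mem_compl_iff, Subtype.forall]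
        exact ⟨fun h j hj hx => hj (h j hx), fun h j hx => by_contra fun hj => h j hj hx⟩
      rw [this]
      exact isOpen_iInter_of_finite fun j => (hKc j).isOpen_compl
    have hcov : (univ : Set X) ⊆ ⋃ o, U o := fun x _ =>
      mem_iUnion.2 ⟨some (P x), fun j hj => by rw [hKmem hj]⟩
    obtain ⟨r, hr, hball⟩ := lebesgue_number_lemma_of_metric isCompact_univ hU hcov
    choose o ho using fun x => hball x (mem_univ x)
    refine ⟨r, hr, fun v => (o v).elim 0 Fin.succ, fun u v huv => ?_⟩
    rcases Fin.eq_zero_or_eq_succ (Q u) with h | ⟨j, h⟩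
    · exact Or.inl h
    · right
      have := ho v (Metric.mem_ball.2 huv) j (hQK h)
      simp [h, this]

/-- Few sets of a family suffice to meet every set of the family that is not too small. -/
theorem exists_finset_inter_nonempty {Z : Type*} [MeasurableSpace X] (μ : Measure X)
    [IsProbabilityMeasure μ]
    {B : Z → Set X} (hB : ∀ x, MeasurableSet (B x)) {b : ℝ} (hb : 0 < b) {E : Set Z}
    (hE : ∀ x ∈ E, b < μ.real (B x)) :
    ∃ F : Finset Z, F.card * b ≤ 1 ∧ ∀ x ∈ E, ∃ z ∈ F, (B x ∩ B z).Nonempty := by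
  classical
  by_contra! hcon
  have bound : ∀ F : Finset Z, (F : Set Z).PairwiseDisjoint B → (∀ z ∈ F, b < μ.real (B z)) →
      F.card * b ≤ 1 := by
    intro F hF hFb
    calc (F.card : ℝ) * b = ∑ _z ∈ F, b := by simp
      _ ≤ ∑ z ∈ F, μ.real (B z) := Finset.sum_le_sum fun z hz => (hFb z hz).le
      _ = μ.real (⋃ z ∈ F, B z) := (measureReal_biUnion_finset hF fun z _ => hB z).symm
      _ ≤ 1 := measureReal_le_one
  have build : ∀ n : ℕ, ∃ F : Finset Z, F.card = n ∧ (F : Set Z).PairwiseDisjoint B ∧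
      ∀ z ∈ F, b < μ.real (B z) := by
    intro n
    induction n with
    | zero => exact ⟨∅, by simp⟩
    | succ n ih =>
      obtain ⟨F, hcard, hF, hFb⟩ := ih
      obtain ⟨x, hxE, hx⟩ := hcon F (bound F hF hFb)
      have hxF : x ∉ F := by
        intro hxF
        have h0 := hx x hxF
        rw [inter_self] at h0
        have := hE x hxE
        rw [h0, measureReal_empty] at this
        exact absurd this hb.not_gt
      refine ⟨insert x F, by rw [Finset.card_insert_of_notMem hxF, hcard], ?_, ?_⟩
      · rw [Finset.coe_insert]
        exact hF.insert fun z hz _ => disjoint_iff_inter_eq_empty.2 (hx z hz)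
      · intro z hz
        rcases Finset.mem_insert.1 hz with rfl | hz
        · exact hE _ hxE
        · exact hFb z hz
  obtain ⟨n, hn⟩ := exists_nat_gt (1 / b)
  obtain ⟨F, hcard, hF, hFb⟩ := build n
  have := bound F hF hFb
  rw [hcard] at this
  rw [div_lt_iff₀ hb] at hn
  linarith

end Approximation

section BallMeasure

variable [MetricSpace X] {φ : ℝ → X → X}

/-- The word read along the walk `j * T + h * ∑ i < j, (d i - 1)` on the orbit of `z`, with some
letters erased. -/
noncomputable def walkWord {k : ℕ} (φ : ℝ → X → X) (code : X → Fin (k + 1)) (T h : ℝ) (z : X)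
    (m : ℕ) (d : Fin m → Fin 3 × Bool) (j : Fin m) : Fin (k + 1) :=
  if (d j).2 then 0 else code (φ (j * T + h * ∑ i ∈ Finset.range j,
    (((extendWord (fun i => (d i).1) i : Fin 3) : ℕ) - 1 : ℝ)) z)

lemma exists_itin_eq_walkWord (hφ : IsFlow φ) {k : ℕ} {Q code : X → Fin (k + 1)} {r T h : ℝ}
    (hcode : ∀ u v, dist u v < r → Q u = 0 ∨ Q u = code v) {m : ℕ} {x z : X} {d : ℕ → Fin 3}
    (hd : ∀ j ≤ m, dist (φ (j * T) x)
      (φ (j * T + h * ∑ i ∈ Finset.range j, (((d i : ℕ) : ℝ) - 1)) z) < r) :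
    ∃ e, itin (φ T) Q m x = walkWord φ code T h z m e := by
  classical
  refine ⟨fun j => (d j, decide (Q (φ (j * T) x) = 0)), funext fun j => ?_⟩
  have hsum : ∑ i ∈ Finset.range j,
      (((extendWord (fun i : Fin m => d i) i : Fin 3) : ℕ) - 1 : ℝ) =
      ∑ i ∈ Finset.range j, (((d i : ℕ) : ℝ) - 1) := by
    refine Finset.sum_congr rfl fun i hi => ?_
    rw [extendWord_of_lt _ ((Finset.mem_range.1 hi).trans j.2)]
  simp only [itin, hφ.iterate_eq, walkWord, decide_eq_true_eq, hsum]
  split_ifs with h0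
  · exact h0
  · exact (hcode _ _ (hd j j.2.le)).resolve_left h0

lemma IsFlow.measurableSet_reparBall [CompactSpace X] [MeasurableSpace X] [BorelSpace X]
    (hφ : IsFlow φ) (x : X) (t ε : ℝ) : MeasurableSet (reparBall φ x t ε) := by
  have := (hφ.isOpen_reparBall_prod t ε).preimage (Continuous.prodMk_right x)
  exact this.measurableSet

/-- With respect to an ergodic measure of infinite entropy, the reparametrization balls of almost
every point decay at any prescribed exponential rate. -/
theorem IsFlow.exists_ae_eventually_measureReal_le [CompactSpace X] [MeasurableSpace X]
    [BorelSpace X] (hφ : IsFlow φ) (hfp : FixedPointFree φ) (μ : Measure X)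
    [IsProbabilityMeasure μ] {T : ℝ} (hT : 0 < T) (ν : Measure X) [IsProbabilityMeasure ν]
    (herg : Ergodic (φ T) ν) (hent : kolSinai ν (φ T) = ⊤) {M : ℝ} (hM : 0 ≤ M) :
    ∃ ε > 0, ∀ᵐ x ∂ν, ∀ᶠ n : ℕ in atTop,
      μ.real (reparBall φ x (n * T) ε) ≤ Real.exp (-(M * n)) := by
  have hlog6 : 0 ≤ Real.log 6 := Real.log_nonneg (by norm_num)
  set H := 2 * M + Real.log 6 + 2 with hHdef
  have hH : 0 ≤ H := by positivity
  obtain ⟨k, P, hP, hlim⟩ : ∃ k : ℕ, ∃ P : X → Fin k, Measurable P ∧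
      ENNReal.ofReal (H + 1 + 2 * Real.log 2 + 2) <
        limsup (fun n : ℕ => ENNReal.ofReal (partEnt ν (itin (φ T) P n) / n)) atTop := by
    have : ENNReal.ofReal (H + 1 + 2 * Real.log 2 + 2) < kolSinai ν (φ T) := by
      rw [hent]; exact ENNReal.ofReal_lt_top
    obtain ⟨k, hk⟩ := lt_iSup_iff.1 this
    obtain ⟨P, hP⟩ := lt_iSup_iff.1 hk
    obtain ⟨hPm, h⟩ := lt_iSup_iff.1 hP
    exact ⟨k, P, hPm, h⟩
  have hlogk : 0 ≤ Real.log (2 * k) := by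
    rw [← Nat.cast_ofNat, ← Nat.cast_mul]
    exact Real.log_natCast_nonneg _
  obtain ⟨Q, hQ, hPQ, hQ0, r, hr, code, hcode⟩ :=
    exists_partial_coding ν hP (δ := 1 / (Real.log (2 * k) + 1)) (by positivity)
  have hQ0' : Real.log (2 * k) * ν.real (Q ⁻¹' {0}) ≤ 1 := by
    refine (mul_le_mul_of_nonneg_left hQ0 hlogk).trans ?_
    rw [mul_one_div, div_le_one (by positivity)]
    linarith
  obtain ⟨h, ε, hε, hwalk⟩ := hφ.exists_walk hfp hT hr
  have hcyl := ae_eventually_cylinder_le herg hP hQ hPQ hQ0' hH hlim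
  refine ⟨ε, hε, ?_⟩
  set E : ℕ → Set X := fun n =>
    {x | Real.exp (-(M * n)) < μ.real (reparBall φ x (n * T) ε)} with hEdef
  set G : ℕ → Set X := fun m =>
    {x | ν.real (itin (φ T) Q m ⁻¹' {itin (φ T) Q m x}) ≤ Real.exp (-(H * m))} with hGdef
  have hcylm : ∀ (m : ℕ) (w : Fin m → Fin (k + 1)),
      ν.real (itin (φ T) Q m ⁻¹' {w} ∩ G m) ≤ Real.exp (-(H * m)) := by
    intro m w
    rcases (itin (φ T) Q m ⁻¹' {w} ∩ G m).eq_empty_or_nonempty with h0 | ⟨x, hx, hxG⟩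
    · rw [h0, measureReal_empty]; positivity
    · rw [← show itin (φ T) Q m x = w from hx]
      exact (measureReal_mono inter_subset_left).trans hxG
  have hEG : ∀ n : ℕ, ν.real (E n ∩ G (n / 2)) ≤ Real.exp (M + 1) * Real.exp (-1) ^ n := by
    intro n
    set m := n / 2 with hm
    have hmn : 2 * m ≤ n := Nat.mul_div_le n 2
    have hnm : (n : ℝ) ≤ 2 * m + 1 := by
      have : n ≤ 2 * m + 1 := by omega
      exact_mod_cast this
    obtain ⟨F, hF, hFE⟩ := exists_finset_inter_nonempty μ
      (B := fun x => reparBall φ x (n * T) ε) (fun x => hφ.measurableSet_reparBall x _ _)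
      (Real.exp_pos (-(M * n))) (E := E n) (fun x hx => hx)
    have hsub : E n ∩ G m ⊆ ⋃ z ∈ F, ⋃ e ∈ (Finset.univ : Finset (Fin m → Fin 3 × Bool)),
        itin (φ T) Q m ⁻¹' {walkWord φ code T h z m e} ∩ G m := by
      rintro x ⟨hxE, hxG⟩
      obtain ⟨z, hzF, w, hwx, hwz⟩ := hFE x hxE
      obtain ⟨d, hd⟩ := hwalk n m x z w hmn hwx hwz
      obtain ⟨e, he⟩ := exists_itin_eq_walkWord hφ hcode hd
      exact mem_biUnion hzF (mem_biUnion (Finset.mem_coe.2 (Finset.mem_univ e)) ⟨he, hxG⟩)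
    have hcard : (Fintype.card (Fin m → Fin 3 × Bool) : ℝ) = Real.exp (Real.log 6 * m) := by
      rw [mul_comm, Real.exp_nat_mul, Real.exp_log (by norm_num)]
      simp [Fintype.card_pi]
    calc ν.real (E n ∩ G m)
        ≤ ∑ z ∈ F, ∑ e : Fin m → Fin 3 × Bool,
            ν.real (itin (φ T) Q m ⁻¹' {walkWord φ code T h z m e} ∩ G m) := by
          refine (measureReal_mono hsub (measure_ne_top _ _)).trans
            ((measureReal_biUnion_finset_le _ _).trans (Finset.sum_le_sum fun z _ => ?_))
          exact measureReal_biUnion_finset_le _ _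
      _ ≤ ∑ z ∈ F, ∑ e : Fin m → Fin 3 × Bool, Real.exp (-(H * m)) :=
          Finset.sum_le_sum fun z _ => Finset.sum_le_sum fun e _ => hcylm m _
      _ = F.card * (Real.exp (Real.log 6 * m) * Real.exp (-(H * m))) := by
          rw [← hcard]
          simp only [Finset.sum_const, nsmul_eq_mul, Finset.card_univ]
      _ ≤ Real.exp (M * n) * (Real.exp (Real.log 6 * m) * Real.exp (-(H * m))) := by
          refine mul_le_mul_of_nonneg_right ?_ (by positivity)
          rwa [Real.exp_neg, ← div_eq_mul_inv, div_le_one (Real.exp_pos _)] at hF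
      _ ≤ Real.exp (M + 1) * Real.exp (-1) ^ n := by
          rw [← Real.exp_nat_mul, ← Real.exp_add, ← Real.exp_add, ← Real.exp_add,
            Real.exp_le_exp, hHdef]
          nlinarith [mul_le_mul_of_nonneg_left hnm hM]
  have hsum : ∑' n : ℕ, ν (E n ∩ G (n / 2)) ≠ ∞ := by
    have hsm : Summable fun n : ℕ => Real.exp (M + 1) * Real.exp (-1) ^ n :=
      (summable_geometric_of_lt_one (Real.exp_pos _).le
        (Real.exp_lt_one_iff.2 (by norm_num))).mul_left _
    refine ne_top_of_le_ne_top hsm.tsum_ofReal_ne_top (ENNReal.tsum_le_tsum fun n => ?_)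
    rw [← ofReal_measureReal]
    exact ENNReal.ofReal_le_ofReal (hEG n)
  have hBC : ∀ᵐ x ∂ν, ¬ ∃ᶠ n in atTop, x ∈ E n ∩ G (n / 2) :=
    measure_eq_zero_iff_ae_notMem.1 (measure_setOfPred_frequently_eq_zero hsum)
  have hhalf : Tendsto (fun n : ℕ => n / 2) atTop atTop :=
    Nat.tendsto_div_const_atTop (by norm_num)
  filter_upwards [hBC, hcyl] with x hx1 hx2
  filter_upwards [not_frequently.1 hx1, hhalf.eventually hx2] with n h1 h2
  by_contra hcon
  exact h1 ⟨not_le.1 hcon, h2⟩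

end BallMeasure

section Disintegration

/-- A set that is null for all the fibre measures over a set `S` of the base, meets the preimage
of `S` in a null set. Neither `S` nor the fibre measures are required to be measurable. -/
lemma ae_imp_of_fibre_ae [MeasurableSpace X] {Y : Type*} [MeasurableSpace Y]
    [MeasurableSingletonClass Y] {μ : Measure X} [IsFiniteMeasure μ] {π : Measure Y}
    {μy : Y → Measure X} {ρ : X → Y} (hρ : Measurable ρ)
    (hprob : ∀ y, IsProbabilityMeasure (μy y)) (hfiber : ∀ y, μy y (ρ ⁻¹' {y}) = 1)
    (hdis : ∀ s : Set X, MeasurableSet s → μ s = ∫⁻ y, μy y s ∂π) {S : Set Y} {B : Set X}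
    (hB : MeasurableSet B) (hS : ∀ y ∈ S, μy y B = 0) :
    ∀ᵐ x ∂μ, ρ x ∈ S → x ∉ B := by
  obtain ⟨v, hv, hvle, hvint⟩ := exists_measurable_le_lintegral_eq (μ := π) fun y => μy y B
  set C : Set Y := v ⁻¹' {0} with hC
  have hCm : MeasurableSet C := hv (measurableSet_singleton 0)
  have hBC : MeasurableSet (B ∩ ρ ⁻¹' C) := hB.inter (hρ hCm)
  obtain ⟨w, hw, hwle, hwint⟩ :=
    exists_measurable_le_lintegral_eq (μ := π) fun y => μy y (B ∩ ρ ⁻¹' C)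
  have hvw : ∀ y, v y + w y ≤ μy y B := by
    intro y
    by_cases hy : y ∈ C
    · rw [show v y = 0 from hy, zero_add]
      exact (hwle y).trans (measure_mono inter_subset_left)
    · have hnull : μy y (ρ ⁻¹' {y})ᶜ = 0 :=
        (prob_compl_eq_zero_iff (hρ (measurableSet_singleton y))).2 (hfiber y)
      have hzero : μy y (B ∩ ρ ⁻¹' C) = 0 := by
        refine measure_mono_null ?_ hnull
        rintro x ⟨-, hx⟩ rfl
        exact hy hx
      have : w y = 0 := le_antisymm ((hwle y).trans hzero.le) zero_le
      rw [this, add_zero]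
      exact hvle y
  have hvμ : ∫⁻ y, v y ∂π = μ B := by rw [← hvint, hdis B hB]
  have hwμ : ∫⁻ y, w y ∂π = μ (B ∩ ρ ⁻¹' C) := by rw [← hwint, hdis _ hBC]
  have hadd : μ B + μ (B ∩ ρ ⁻¹' C) ≤ μ B + 0 := by
    rw [← hvμ, ← hwμ, ← lintegral_add_left hv, add_zero, ← hvint]
    exact lintegral_mono hvw
  have hnull : μ (B ∩ ρ ⁻¹' C) = 0 :=
    le_antisymm ((ENNReal.add_le_add_iff_left (measure_ne_top μ B)).1 hadd) zero_le
  filter_upwards [measure_eq_zero_iff_ae_notMem.1 hnull] with x hx hxS hxB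
  exact hx ⟨hxB, le_antisymm ((hvle _).trans (hS _ hxS).le) zero_le⟩

end Disintegration

section LocalRate

lemma measurable_negLogNN : Measurable negLogNN :=
  Measurable.ite (measurableSet_singleton 0) measurable_const
    (ENNReal.measurable_ofReal.comp (Real.measurable_log.comp ENNReal.measurable_toReal).neg)

lemma ofReal_le_negLogNN {a : ℝ≥0∞} (ha : a ≠ ∞) {c : ℝ} (h : a.toReal ≤ Real.exp (-c)) :
    ENNReal.ofReal c ≤ negLogNN a := by
  unfold negLogNN
  split_ifs with h0
  · exact le_top
  · refine ENNReal.ofReal_le_ofReal ?_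
    have := Real.log_le_log (ENNReal.toReal_pos h0 ha) h
    rw [Real.log_exp] at this
    linarith

variable [MetricSpace X] {φ : ℝ → X → X}

lemma localRate_anti [MeasurableSpace X] (μ : Measure X) [IsFiniteMeasure μ] (x : X) (t : ℝ)
    {ε ε' : ℝ} (h : ε ≤ ε') : localRate μ φ x ε' t ≤ localRate μ φ x ε t := by
  have hsub : μ (reparBall φ x t ε) ≤ μ (reparBall φ x t ε') :=
    measure_mono fun y ⟨α, hα, hy⟩ => ⟨α, hα, fun s hs => (hy s hs).trans_le h⟩
  refine ENNReal.div_le_div_right ?_ _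
  unfold negLogNN
  split_ifs with h1 h2 h2
  · exact le_top
  · exact absurd (le_antisymm (hsub.trans h1.le) zero_le) h2
  · exact le_top
  · refine ENNReal.ofReal_le_ofReal (neg_le_neg (Real.log_le_log (ENNReal.toReal_pos h2
      (measure_ne_top _ _)) (ENNReal.toReal_mono (measure_ne_top _ _) hsub)))

lemma IsFlow.measurable_localRate [CompactSpace X] [MeasurableSpace X] [BorelSpace X]
    (hφ : IsFlow φ) (μ : Measure X) [IsFiniteMeasure μ] (ε t : ℝ) :
    Measurable fun x => localRate μ φ x ε t :=
  (measurable_negLogNN.comp (measurable_measure_prodMk_left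
    (hφ.isOpen_reparBall_prod t ε).measurableSet)).div_const _

/-- With respect to an ergodic measure of infinite entropy, the lower local rate is almost
everywhere infinite. -/
theorem IsFlow.ae_iSup_liminf_localRate_eq_top [CompactSpace X] [MeasurableSpace X]
    [BorelSpace X] (hφ : IsFlow φ) (hfp : FixedPointFree φ) (μ : Measure X)
    [IsProbabilityMeasure μ] {T : ℝ} (hT : 0 < T) (ν : Measure X) [IsProbabilityMeasure ν]
    (herg : Ergodic (φ T) ν) (hent : kolSinai ν (φ T) = ⊤) :
    ∀ᵐ x ∂ν, ⨆ k : ℕ, liminf (fun n : ℕ => localRate μ φ x (1 / ((k : ℝ) + 1)) (n * T)) atTop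
      = ⊤ := by
  have hM : ∀ M : ℕ, ∃ ε > 0, ∀ᵐ x ∂ν, ∀ᶠ n : ℕ in atTop,
      μ.real (reparBall φ x (n * T) ε) ≤ Real.exp (-(M * T * n)) := fun M =>
    hφ.exists_ae_eventually_measureReal_le hfp μ hT ν herg hent (by positivity)
  choose ε hε hball using hM
  filter_upwards [ae_all_iff.2 hball] with x hx
  refine ENNReal.eq_top_of_forall_nnreal_le fun a => ?_
  obtain ⟨M, hMa⟩ := exists_nat_ge a
  obtain ⟨k, hk⟩ := exists_nat_one_div_lt (hε M)
  refine le_trans ?_ (le_iSup _ k)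
  refine le_liminf_of_le (by isBoundedDefault) ?_
  filter_upwards [hx M, eventually_ge_atTop 1] with n hn hn1
  refine le_trans ?_ (localRate_anti μ x _ hk.le)
  have hnT : 0 < (n : ℝ) * T := mul_pos (by exact_mod_cast hn1) hT
  refine (show (a : ℝ≥0∞) ≤ M by exact_mod_cast hMa).trans ?_
  rw [localRate, ENNReal.le_div_iff_mul_le (Or.inl (ENNReal.ofReal_pos.2 hnT).ne')
    (Or.inl ENNReal.ofReal_ne_top), ← ENNReal.ofReal_natCast,
    ← ENNReal.ofReal_mul (Nat.cast_nonneg M)]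
  refine ofReal_le_negLogNN (measure_ne_top _ _) (hn.trans (Real.exp_le_exp.2 (le_of_eq ?_)))
  ring

end LocalRate

/-- **Claim 1 (2).** Let `μ = ∫_Y μ_y dπ(y)` be the ergodic decomposition of `μ` with
respect to `φ_{Lτ}` and let `X_∞` be the union of ergodic components of infinite entropy.
Then for `μ`-a.e. `x ∈ X_∞`,
`lim_{ε→0} liminf_{n→∞} −(1/(nLτ)) log μ(B(x,nLτ,ε,φ)) = ∞`. -/
theorem liminf_rate_infinite_on_infinite_components {X : Type*} [MetricSpace X]
    [CompactSpace X] [MeasurableSpace X] [BorelSpace X]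
    {Y : Type*} [MeasurableSpace Y] [MeasurableSingletonClass Y]
    (φ : ℝ → X → X) (hφ : IsFlow φ) (hfp : FixedPointFree φ)
    (μ : Measure X) [IsProbabilityMeasure μ] (hinv : FlowInvariant φ μ)
    (τ : ℝ) (hτ : 0 < τ) (L : ℕ) (hL : 0 < L)
    (π : Measure Y) [IsProbabilityMeasure π]
    (μy : Y → Measure X) (ρ : X → Y) (hρ : Measurable ρ)
    (hprob : ∀ y, IsProbabilityMeasure (μy y))
    (herg : ∀ y, Ergodic (φ ((L : ℝ) * τ)) (μy y))
    (hfiber : ∀ y, μy y (ρ ⁻¹' {y}) = 1)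
    (hdis : ∀ s : Set X, MeasurableSet s → μ s = ∫⁻ y, μy y s ∂π) :
    ∀ᵐ x ∂μ, x ∈ ρ ⁻¹' {y | kolSinai (μy y) (φ ((L : ℝ) * τ)) = ⊤} →
      (⨆ (ε : ℝ) (_ : 0 < ε),
        Filter.liminf (fun n : ℕ => localRate μ φ x ε ((n : ℝ) * ((L : ℝ) * τ)))
          Filter.atTop) = ⊤ := by
  have hT : 0 < (L : ℝ) * τ := mul_pos (Nat.cast_pos.2 hL) hτ
  have hmeas : Measurable fun x => ⨆ k : ℕ,
      liminf (fun n : ℕ => localRate μ φ x (1 / ((k : ℝ) + 1)) (n * ((L : ℝ) * τ))) atTop :=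
    Measurable.iSup fun k => Measurable.liminf fun n => hφ.measurable_localRate μ _ _
  have hbad := ae_imp_of_fibre_ae hρ hprob hfiber hdis
    (S := {y | kolSinai (μy y) (φ ((L : ℝ) * τ)) = ⊤})
    (hmeas (measurableSet_singleton ⊤)).compl fun y hy =>
      haveI := hprob y
      hφ.ae_iSup_liminf_localRate_eq_top hfp μ hT (μy y) (herg y) hy
  filter_upwards [hbad] with x hx hxS
  have hxtop : ⨆ k : ℕ,
      liminf (fun n : ℕ => localRate μ φ x (1 / ((k : ℝ) + 1)) (n * ((L : ℝ) * τ))) atTop = ⊤ :=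
    not_not.1 (hx hxS)
  refine top_le_iff.1 (hxtop.symm.le.trans (iSup_le fun k => ?_))
  exact le_iSup₂_of_le (1 / ((k : ℝ) + 1)) (by positivity) le_rfl

end FlowEntropy
end
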